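/- Fix a real number α with 1/2 < α < 1 and set t = α²/(α² + (1-α)²). There exist a constant C > 0 and N such that for every integer n ≥ N, every tree T* on n vertices maximizing Ψ(T,α) = αλ₁(T) + (1-α)λ₂(T) over all trees T on n vertices contains two distinct vertices u₁ and u₂ with |deg(u₁) - t·n| ≤ C and |deg(u₂) - (1-t)·n| ≤ C, and every vertex u of T* other than u₁ and u₂ satisfies deg(u) ≤ C. -/

import Mathlib

open scoped Classical

/-- Adjacency matrix of a simple graph on `Fin n`, over `ℝ`. -/
noncomputable def adjMat {n : ℕ} (G : SimpleGraph (Fin n)) : Matrix (Fin n) (Fin n) ℝ :=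
  fun i j => if G.Adj i j then 1 else 0

/-- The eigenvalues (roots of the characteristic polynomial, with multiplicity)
of the adjacency matrix, sorted in nondecreasing order. -/
noncomputable def eigList {n : ℕ} (G : SimpleGraph (Fin n)) : List ℝ :=
  (Matrix.charpoly (adjMat G)).roots.sort (· ≤ ·)

/-- `lam k G` is the `k`-th largest adjacency eigenvalue of `G` (so `lam 1` is `λ₁`). -/
noncomputable def lam {n : ℕ} (k : ℕ) (G : SimpleGraph (Fin n)) : ℝ :=
  (eigList G).getD (n - k) 0

/-- The double comet `DC(k1, k2, l)`: a path on `l` vertices (the vertices `0, …, l-1`),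
with `k1` pendant leaves attached to the terminal vertex `0` and `k2` pendant leaves
attached to the terminal vertex `l - 1`. -/
def doubleComet (k1 k2 l : ℕ) : SimpleGraph (Fin (k1 + k2 + l)) :=
  SimpleGraph.fromRel (fun i j =>
    ((i : ℕ) + 1 = (j : ℕ) ∧ (j : ℕ) < l) ∨
    (l ≤ (i : ℕ) ∧ (i : ℕ) < l + k1 ∧ (j : ℕ) = 0) ∨
    (l + k1 ≤ (i : ℕ) ∧ (j : ℕ) = l - 1))

/-- Degree of a vertex. -/
noncomputable def deg {n : ℕ} (G : SimpleGraph (Fin n)) (u : Fin n) : ℕ :=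
  (Finset.univ.filter (fun w => G.Adj u w)).card

open Matrix in
lemma adjMat_herm {n : ℕ} (G : SimpleGraph (Fin n)) : (adjMat G).IsHermitian := by
  ext i j
  simp [adjMat, Matrix.conjTranspose_apply, G.adj_comm]

lemma eigList_eq {n : ℕ} (G : SimpleGraph (Fin n)) :
    eigList G = (List.ofFn (adjMat_herm G).eigenvalues₀).reverse := by
  unfold eigList
  apply List.Perm.eq_of_sortedLE
  · exact (Multiset.pairwise_sort _ _).sortedLE
  · rw [List.sortedLE_reverse]
    exact ((adjMat_herm G).eigenvalues₀_antitone).sortedGE_ofFn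
  · rw [← Multiset.coe_eq_coe, Multiset.sort_eq, ← Multiset.coe_reverse, List.reverse_reverse,
      (adjMat_herm G).roots_charpoly_eq_eigenvalues₀, Fin.univ_val_map]
    rfl

lemma dot_inner {n : ℕ} (f g : EuclideanSpace ℝ (Fin n)) :
    (f : Fin n → ℝ) ⬝ᵥ (g : Fin n → ℝ) = inner ℝ f g := by
  simp [PiLp.inner_apply, dotProduct, mul_comm]

open Matrix in
lemma spec {n : ℕ} (hn : 2 ≤ n) (G : SimpleGraph (Fin n)) :
    ∃ (v : Fin n → Fin n → ℝ) (l : Fin n → ℝ),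
      (∀ i j, v i ⬝ᵥ v j = if i = j then 1 else 0) ∧
      (∀ i, adjMat G *ᵥ v i = l i • v i) ∧ Antitone l ∧
      (∀ f g : Fin n → ℝ, f ⬝ᵥ g = ∑ i, (f ⬝ᵥ v i) * (g ⬝ᵥ v i)) ∧
      lam 1 G = l ⟨0, by omega⟩ ∧ lam 2 G = l ⟨1, by omega⟩ := by
  set hA := adjMat_herm G
  have hc : Fintype.card (Fin n) = n := Fintype.card_fin n
  let e : Fin (Fintype.card (Fin n)) ≃ Fin n := Fintype.equivOfCardEq (Fintype.card_fin _)
  let c : Fin n ≃ Fin (Fintype.card (Fin n)) := finCongr hc.symm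
  let b := hA.eigenvectorBasis
  let b' := b.reindex (c.trans e).symm
  have hb' : ∀ i, b' i = b (e (c i)) := fun i => by simp [b']
  refine ⟨fun i => (b' i : Fin n → ℝ), fun i => hA.eigenvalues₀ (c i), ?_, ?_, ?_, ?_, ?_, ?_⟩
  · intro i j
    rw [dot_inner]
    exact (orthonormal_iff_ite.mp b'.orthonormal) i j
  · intro i
    simp only [hb']
    have := hA.mulVec_eigenvectorBasis (e (c i))
    rw [this]
    congr 1
    simp [Matrix.IsHermitian.eigenvalues, e]
  · intro i j hij
    exact hA.eigenvalues₀_antitone hij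
  · intro f g
    have := b'.sum_inner_mul_inner (WithLp.toLp 2 f) (WithLp.toLp 2 g)
    have h2 := dot_inner (WithLp.toLp 2 f) (WithLp.toLp 2 g)
    simp only at h2
    rw [h2, ← this]
    refine Finset.sum_congr rfl fun i _ => ?_
    rw [← dot_inner, ← dot_inner, dotProduct_comm (WithLp.ofLp (b' i))]
  · unfold lam
    rw [eigList_eq]
    rw [List.getD_eq_getElem _ _ (by simp; omega)]
    simp [c]
  · unfold lam
    rw [eigList_eq]
    rw [List.getD_eq_getElem _ _ (by simp; omega)]
    simp [c]
    congr 1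
    ext
    simp
    omega

open Matrix in
lemma adj_symm_dot {n : ℕ} (G : SimpleGraph (Fin n)) (f g : Fin n → ℝ) :
    f ⬝ᵥ (adjMat G *ᵥ g) = (adjMat G *ᵥ f) ⬝ᵥ g := by
  have h : (adjMat G)ᵀ = adjMat G := by
    have := adjMat_herm G
    rwa [Matrix.IsHermitian, Matrix.conjTranspose_eq_transpose_of_trivial] at this
  rw [dotProduct_mulVec, ← mulVec_transpose, h]

/-- quadratic form extremal inequality -/
lemma pq_bound (α β c p q : ℝ) (hβ : 0 ≤ β) (hαβ : β < α) (hp : p ^ 2 ≤ 1)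
    (hpq : (q - c * p) ^ 2 ≤ 1 - p ^ 2) :
    α * p ^ 2 + β * q ^ 2 ≤ α + α * β / (α - β) * c ^ 2 := by
  have hd : 0 < α - β := by linarith
  set r := q - c * p with hr
  have hq : q = c * p + r := by rw [hr]; ring
  rw [hq]
  have h1 : α * p ^ 2 + β * (c * p + r) ^ 2 ≤ α + α * β / (α - β) * (c ^ 2 * p ^ 2) := by
    rw [div_mul_eq_mul_div, ← sub_le_iff_le_add', le_div_iff₀ hd]
    nlinarith [sq_nonneg ((α - β) * r - β * c * p), mul_nonneg hd.le (mul_nonneg (by linarith : (0:ℝ) ≤ α) (by linarith : (0:ℝ) ≤ 1 - p ^ 2 - r ^ 2))]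
  have h2 : α * β / (α - β) * (c ^ 2 * p ^ 2) ≤ α * β / (α - β) * c ^ 2 := by
    apply mul_le_mul_of_nonneg_left
    · nlinarith [sq_nonneg c]
    · have : 0 ≤ α := by linarith
      positivity
  linarith

open Matrix in
lemma kyfan {n : ℕ} (hn : 2 ≤ n) (G : SimpleGraph (Fin n)) (α β c : ℝ) (hβ : 0 ≤ β)
    (hαβ : β < α) (f g : Fin n → ℝ) (hf : f ⬝ᵥ f = 1) (hg : g ⬝ᵥ g = 1) (hfg : f ⬝ᵥ g = c) :
    α * (f ⬝ᵥ (adjMat G *ᵥ f)) + β * (g ⬝ᵥ (adjMat G *ᵥ g)) ≤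
      α * lam 1 G + β * lam 2 G + (lam 1 G - lam 2 G) * (α * β / (α - β) * c ^ 2) := by
  obtain ⟨v, l, hv, hl, hanti, hpars, h1, h2⟩ := spec hn G
  have hq : ∀ f : Fin n → ℝ, f ⬝ᵥ (adjMat G *ᵥ f) = ∑ i, l i * (f ⬝ᵥ v i) ^ 2 := by
    intro f
    rw [hpars]
    refine Finset.sum_congr rfl fun i _ => ?_
    rw [← adj_symm_dot, hl, dotProduct_smul, smul_eq_mul]
    ring
  have hn2 : ∀ f : Fin n → ℝ, f ⬝ᵥ f = ∑ i, (f ⬝ᵥ v i) ^ 2 := by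
    intro f
    rw [hpars]
    refine Finset.sum_congr rfl fun i _ => by ring
  set i0 : Fin n := ⟨0, by omega⟩
  set i1 : Fin n := ⟨1, by omega⟩
  rw [h1, h2]
  have hF := hn2 f
  have hG := hn2 g
  rw [hf] at hF
  rw [hg] at hG
  -- first coefficient
  have hfirst : α * (f ⬝ᵥ v i0) ^ 2 + β * (g ⬝ᵥ v i0) ^ 2 ≤ α + α * β / (α - β) * c ^ 2 := by
    apply pq_bound α β c _ _ hβ hαβ
    · rw [hF]
      exact Finset.single_le_sum (f := fun i => (f ⬝ᵥ v i) ^ 2) (fun i _ => sq_nonneg _) (Finset.mem_univ i0)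
    · -- Bessel via sums
      have hc : ∑ i, (f ⬝ᵥ v i) * (g ⬝ᵥ v i) = c := by rw [← hpars, hfg]
      set p := f ⬝ᵥ v i0
      set q := g ⬝ᵥ v i0
      -- vector w = v0 - p f
      have hw := hn2 (v i0 - p • f - (q - c * p) • (g - c • f))
      have hw0 : 0 ≤ (v i0 - p • f - (q - c * p) • (g - c • f)) ⬝ᵥ (v i0 - p • f - (q - c * p) • (g - c • f)) := by
        rw [hw]; exact Finset.sum_nonneg fun i _ => sq_nonneg _
      have hv0 : v i0 ⬝ᵥ v i0 = 1 := by rw [hv]; simp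
      have e1 : v i0 ⬝ᵥ f = p := dotProduct_comm _ _
      have e2 : v i0 ⬝ᵥ g = q := dotProduct_comm _ _
      have e3 : g ⬝ᵥ f = c := by rw [dotProduct_comm, hfg]
      have e4 : f ⬝ᵥ v i0 = p := rfl
      have e5 : g ⬝ᵥ v i0 = q := rfl
      simp only [sub_dotProduct, dotProduct_sub, smul_dotProduct, dotProduct_smul, smul_eq_mul,
        hv0, e1, e2, e3, e4, e5, hf, hg, hfg] at hw0
      nlinarith [hw0, sq_nonneg (c * (q - c * p))]
  have hkey : ∀ i, (l i - l i1) * (α * (f ⬝ᵥ v i) ^ 2 + β * (g ⬝ᵥ v i) ^ 2) ≤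
      if i = i0 then (l i0 - l i1) * (α + α * β / (α - β) * c ^ 2) else 0 := by
    intro i
    split_ifs with hi
    · subst hi
      apply mul_le_mul_of_nonneg_left hfirst
      have : l i1 ≤ l i0 := hanti (by simp [i0, i1, Fin.le_def])
      linarith
    · have : l i ≤ l i1 := by
        apply hanti
        have : i.val ≠ 0 := fun h => hi (Fin.ext h)
        simp [i1, Fin.le_def]; omega
      apply mul_nonpos_of_nonpos_of_nonneg
      · linarith
      · have : 0 ≤ α := by linarith
        positivity
  have hsum := Finset.sum_le_sum (fun i (_ : i ∈ Finset.univ) => hkey i)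
  rw [Finset.sum_ite_eq' Finset.univ i0] at hsum
  simp only [Finset.mem_univ, if_true] at hsum
  have hexp : ∑ i, (l i - l i1) * (α * (f ⬝ᵥ v i) ^ 2 + β * (g ⬝ᵥ v i) ^ 2)
      = α * ∑ i, l i * (f ⬝ᵥ v i) ^ 2 + β * ∑ i, l i * (g ⬝ᵥ v i) ^ 2
        - l i1 * (α * ∑ i, (f ⬝ᵥ v i) ^ 2 + β * ∑ i, (g ⬝ᵥ v i) ^ 2) := by
    simp only [Finset.mul_sum, ← Finset.sum_add_distrib, ← Finset.sum_sub_distrib]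
    refine Finset.sum_congr rfl fun i _ => by ring
  rw [hexp, ← hF, ← hG] at hsum
  rw [hq, hq]
  nlinarith [hsum]

open Matrix in
lemma bessel {m n : ℕ} (f : Fin m → Fin n → ℝ)
    (hf : ∀ i j, f i ⬝ᵥ f j = if i = j then 1 else 0) (b : Fin n → ℝ) :
    ∑ k, (b ⬝ᵥ f k) ^ 2 ≤ b ⬝ᵥ b := by
  have h0 : 0 ≤ (b - ∑ k, (b ⬝ᵥ f k) • f k) ⬝ᵥ (b - ∑ k, (b ⬝ᵥ f k) • f k) := by
    rw [dotProduct]; exact Finset.sum_nonneg fun i _ => mul_self_nonneg _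
  have h1 : b ⬝ᵥ (∑ k, (b ⬝ᵥ f k) • f k) = ∑ k, (b ⬝ᵥ f k) ^ 2 := by
    rw [dotProduct_sum]
    refine Finset.sum_congr rfl fun k _ => ?_
    rw [dotProduct_smul, smul_eq_mul]; ring
  have h2 : (∑ k, (b ⬝ᵥ f k) • f k) ⬝ᵥ (∑ k, (b ⬝ᵥ f k) • f k) = ∑ k, (b ⬝ᵥ f k) ^ 2 := by
    rw [dotProduct_sum]
    refine Finset.sum_congr rfl fun k _ => ?_
    rw [sum_dotProduct]
    simp [dotProduct_smul, smul_dotProduct, hf]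
    ring
  rw [sub_dotProduct, dotProduct_sub, dotProduct_sub, h2, h1, dotProduct_comm (∑ k, (b ⬝ᵥ f k) • f k) b, h1] at h0
  linarith

open Matrix in
lemma frob {m n : ℕ} (f : Fin m → Fin n → ℝ)
    (hf : ∀ i j, f i ⬝ᵥ f j = if i = j then 1 else 0) (B : Matrix (Fin n) (Fin n) ℝ) :
    ∑ k, (B *ᵥ f k) ⬝ᵥ (B *ᵥ f k) ≤ ∑ i, ∑ j, B i j ^ 2 := by
  simp only [dotProduct]
  rw [Finset.sum_comm]
  refine Finset.sum_le_sum fun i _ => ?_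
  have := bessel f hf (B i)
  simp only [mulVec]
  calc _ = ∑ k, (B i ⬝ᵥ f k) ^ 2 := Finset.sum_congr rfl fun k _ => by ring
    _ ≤ _ := this
    _ = _ := by rw [dotProduct]; exact Finset.sum_congr rfl fun k _ => by ring

lemma adj_row_sum {n : ℕ} (G : SimpleGraph (Fin n)) (i : Fin n) :
    ∑ j, adjMat G i j = deg G i := by
  simp [adjMat, deg]

lemma adj_symm' {n : ℕ} (G : SimpleGraph (Fin n)) (i j : Fin n) : adjMat G i j = adjMat G j i := by
  simp [adjMat, G.adj_comm]

lemma deg_eq_degree {n : ℕ} (G : SimpleGraph (Fin n)) (i : Fin n) : deg G i = G.degree i := by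
  unfold deg
  rw [← SimpleGraph.card_neighborFinset_eq_degree]
  congr 1
  ext w
  simp

lemma sum_deg_tree {n : ℕ} (G : SimpleGraph (Fin n)) (hG : G.IsTree) :
    ∑ i, (deg G i : ℝ) = 2 * ((n : ℝ) - 1) := by
  have h1 := G.sum_degrees_eq_twice_card_edges
  have h2 := hG.card_edgeFinset
  rw [Fintype.card_fin] at h2
  have : ∑ i, deg G i = 2 * G.edgeFinset.card := by
    rw [← h1]
    exact Finset.sum_congr rfl fun i _ => deg_eq_degree G i
  have h3 : (n : ℝ) = G.edgeFinset.card + 1 := by exact_mod_cast h2.symm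
  have h4 : ((∑ i, deg G i : ℕ) : ℝ) = ((2 * G.edgeFinset.card : ℕ) : ℝ) := by rw [this]
  push_cast at h4
  linarith

lemma common_nbr {n : ℕ} (G : SimpleGraph (Fin n)) (hG : G.IsTree) {i j k k' : Fin n}
    (hij : i ≠ j) (h1 : G.Adj i k) (h2 : G.Adj k j) (h3 : G.Adj i k') (h4 : G.Adj k' j) : k = k' := by
  let p : G.Walk i j := .cons h1 (.cons h2 .nil)
  let q : G.Walk i j := .cons h3 (.cons h4 .nil)
  have hp : p.IsPath := by
    simp [p, SimpleGraph.Walk.cons_isPath_iff, h1.ne, h2.ne, hij]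
  have hq : q.IsPath := by
    simp [q, SimpleGraph.Walk.cons_isPath_iff, h3.ne, h4.ne, hij]
  have := (hG.existsUnique_path i j).unique hp hq
  have h5 := congrArg (fun w : G.Walk i j => w.support) this
  simpa [p, q] using h5

open Matrix in
lemma sq_entry_sum {n : ℕ} (G : SimpleGraph (Fin n)) (hG : G.IsTree) :
    ∑ i, ∑ j, ((adjMat G * adjMat G) i j) ^ 2 ≤ 2 * (∑ i, (deg G i : ℝ) ^ 2) - 2 * ((n : ℝ) - 1) := by
  have hdiag : ∀ i, (adjMat G * adjMat G) i i = deg G i := by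
    intro i
    rw [mul_apply, ← adj_row_sum]
    refine Finset.sum_congr rfl fun j _ => ?_
    rw [adj_symm' G j i]; simp [adjMat]
  have hoff : ∀ i j, i ≠ j → ((adjMat G * adjMat G) i j) ^ 2 ≤ (adjMat G * adjMat G) i j := by
    intro i j hij
    have h0 : 0 ≤ (adjMat G * adjMat G) i j := by
      rw [mul_apply]
      refine Finset.sum_nonneg fun k _ => ?_
      unfold adjMat; split_ifs <;> simp
    have h1 : (adjMat G * adjMat G) i j ≤ 1 := by
      rw [mul_apply]
      have : ∀ k, adjMat G i k * adjMat G k j = if G.Adj i k ∧ G.Adj k j then 1 else 0 := by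
        intro k; unfold adjMat; by_cases h : G.Adj i k <;> by_cases h' : G.Adj k j <;> simp [h, h']
      simp only [this]
      rw [Finset.sum_boole]
      norm_cast
      rw [Finset.card_le_one]
      intro a ha b hb
      simp only [Finset.mem_filter, Finset.mem_univ, true_and] at ha hb
      exact common_nbr G hG hij ha.1 ha.2 hb.1 hb.2
    nlinarith
  have hall : ∀ i j, ((adjMat G * adjMat G) i j) ^ 2 ≤ (adjMat G * adjMat G) i j +
      if i = j then ((deg G i : ℝ) ^ 2 - deg G i) else 0 := by
    intro i j
    split_ifs with h
    · subst h; rw [hdiag]; linarith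
    · linarith [hoff i j h]
  calc _ ≤ ∑ i, ∑ j, ((adjMat G * adjMat G) i j +
      if i = j then ((deg G i : ℝ) ^ 2 - deg G i) else 0) :=
        Finset.sum_le_sum fun i _ => Finset.sum_le_sum fun j _ => hall i j
    _ = ∑ i, ∑ j, (adjMat G * adjMat G) i j + (∑ i, (deg G i : ℝ) ^ 2 - ∑ i, (deg G i : ℝ)) := by
        simp [Finset.sum_add_distrib]
    _ = _ := by
        have : ∑ i, ∑ j, (adjMat G * adjMat G) i j = ∑ i, (deg G i : ℝ) ^ 2 := by
          simp only [mul_apply]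
          have h1 : ∀ i, ∑ j, ∑ k, adjMat G i k * adjMat G k j = ∑ k, adjMat G i k * deg G k := by
            intro i
            rw [Finset.sum_comm]
            refine Finset.sum_congr rfl fun k _ => ?_
            rw [← Finset.mul_sum, adj_row_sum]
          simp only [h1]
          rw [Finset.sum_comm]
          refine Finset.sum_congr rfl fun k _ => ?_
          rw [← Finset.sum_mul]
          simp only [adj_symm' G _ k]
          rw [adj_row_sum]; ring
        rw [this, sum_deg_tree G hG]; ring

lemma sq_sum_one {n : ℕ} (G : SimpleGraph (Fin n)) (hG : G.IsTree) :
    ∑ i, ∑ j, (adjMat G i j) ^ 2 = 2 * ((n : ℝ) - 1) := by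
  rw [← sum_deg_tree G hG]
  refine Finset.sum_congr rfl fun i _ => ?_
  rw [← adj_row_sum]
  refine Finset.sum_congr rfl fun j _ => ?_
  simp [adjMat]

open Matrix in
lemma sign_exists {n : ℕ} (G : SimpleGraph (Fin n)) (hG : G.IsTree) :
    ∃ s : Fin n → ℝ, (∀ i, s i * s i = 1) ∧ ∀ (z : Fin n → ℝ) (x : ℝ),
      adjMat G *ᵥ z = x • z → adjMat G *ᵥ (fun i => s i * z i) = (-x) • (fun i => s i * z i) := by
  obtain ⟨C⟩ := hG.colorable_two
  refine ⟨fun i => if C i = 0 then 1 else -1, fun i => by dsimp only; split_ifs <;> simp, fun z x h => ?_⟩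
  ext i
  have hi := congrFun h i
  simp only [mulVec, dotProduct, Pi.smul_apply, smul_eq_mul] at hi ⊢
  have : ∀ j, adjMat G i j * ((if C j = 0 then (1:ℝ) else -1) * z j) =
      -(if C i = 0 then (1:ℝ) else -1) * (adjMat G i j * z j) := by
    intro j
    unfold adjMat
    split_ifs with h1 h2 h3 h4 h5 <;> simp
    · exact (C.valid h1 (h3.trans h2.symm)).elim
    · exact (C.valid h1 (by omega)).elim
  simp only [this]
  rw [← Finset.mul_sum, hi]; ring

open Matrix in
lemma eig_orth {n : ℕ} (G : SimpleGraph (Fin n)) (z w : Fin n → ℝ) (x y : ℝ)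
    (hz : adjMat G *ᵥ z = x • z) (hw : adjMat G *ᵥ w = y • w) (hxy : x ≠ y) : z ⬝ᵥ w = 0 := by
  have := adj_symm_dot G z w
  rw [hz, hw, dotProduct_smul, smul_dotProduct, smul_eq_mul, smul_eq_mul] at this
  have h : (y - x) * (z ⬝ᵥ w) = 0 := by linarith
  rcases mul_eq_zero.mp h with h | h
  · exact absurd (by linarith) hxy
  · exact h

open Matrix in
lemma lam1_sq_le {n : ℕ} (hn : 2 ≤ n) (G : SimpleGraph (Fin n)) (hG : G.IsTree) (h : 0 < lam 1 G) :
    lam 1 G ^ 2 ≤ n - 1 := by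
  obtain ⟨v, l, hv, hl, hanti, hpars, h1, h2⟩ := spec hn G
  obtain ⟨s, hs, hsz⟩ := sign_exists G hG
  set z := v ⟨0, by omega⟩
  have hz1 : adjMat G *ᵥ z = (lam 1 G) • z := by rw [h1]; exact hl _
  have hz2 := hsz z _ hz1
  have ho := eig_orth G _ _ _ _ hz1 hz2 (by linarith)
  have hzz : z ⬝ᵥ z = 1 := by simp [z, hv]
  have hss : (fun i => s i * z i) ⬝ᵥ (fun i => s i * z i) = z ⬝ᵥ z := by
    simp only [dotProduct]
    refine Finset.sum_congr rfl fun i _ => ?_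
    linear_combination (z i * z i) * hs i
  have ho' := ho
  rw [dotProduct_comm] at ho'
  have := frob ![z, fun i => s i * z i] (by
    intro i j
    fin_cases i <;> fin_cases j <;> simp [hzz, hss, ho, ho']) (adjMat G)
  rw [sq_sum_one G hG] at this
  simp only [Fin.sum_univ_two, Matrix.cons_val_zero, Matrix.cons_val_one, hz1, hz2,
    smul_dotProduct, dotProduct_smul, smul_eq_mul, hss, hzz] at this
  nlinarith

open Matrix in
lemma lam12_bounds {n : ℕ} (hn : 2 ≤ n) (G : SimpleGraph (Fin n)) (hG : G.IsTree)
    (h : 0 < lam 2 G) :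
    lam 1 G ^ 2 + lam 2 G ^ 2 ≤ n - 1 ∧
    (lam 1 G ^ 2) ^ 2 + (lam 2 G ^ 2) ^ 2 + (n - 1) ≤ ∑ i, (deg G i : ℝ) ^ 2 := by
  obtain ⟨v, l, hv, hl, hanti, hpars, h1, h2⟩ := spec hn G
  obtain ⟨s, hs, hsz⟩ := sign_exists G hG
  set z := v ⟨0, by omega⟩
  set w := v ⟨1, by omega⟩
  have hx : lam 2 G ≤ lam 1 G := by
    rw [h1, h2]; apply hanti; simp [Fin.le_def]
  have hz1 : adjMat G *ᵥ z = (lam 1 G) • z := by rw [h1]; exact hl _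
  have hw1 : adjMat G *ᵥ w = (lam 2 G) • w := by rw [h2]; exact hl _
  have hz2 := hsz z _ hz1
  have hw2 := hsz w _ hw1
  have o1 := eig_orth G _ _ _ _ hz1 hz2 (by linarith)
  have o2 := eig_orth G _ _ _ _ hw1 hw2 (by linarith)
  have o3 := eig_orth G _ _ _ _ hz1 hw2 (by linarith)
  have o4 := eig_orth G _ _ _ _ hw1 hz2 (by linarith)
  have o1' := o1
  have o2' := o2
  have o3' := o3
  have o4' := o4
  rw [dotProduct_comm] at o1' o2' o3' o4'
  have hzz : z ⬝ᵥ z = 1 := by simp [z, hv]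
  have hww : w ⬝ᵥ w = 1 := by simp [w, hv]
  have hzw : z ⬝ᵥ w = 0 := by simp [z, w, hv]
  have hwz : w ⬝ᵥ z = 0 := by simp [z, w, hv]
  have hss : ∀ a b : Fin n → ℝ, (fun i => s i * a i) ⬝ᵥ (fun i => s i * b i) = a ⬝ᵥ b := by
    intro a b
    simp only [dotProduct]
    refine Finset.sum_congr rfl fun i _ => ?_
    linear_combination (a i * b i) * hs i
  have hon : ∀ i j, (![z, w, fun i => s i * z i, fun i => s i * w i] : Fin 4 → Fin n → ℝ) i ⬝ᵥ
      (![z, w, fun i => s i * z i, fun i => s i * w i] : Fin 4 → Fin n → ℝ) j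
        = if i = j then 1 else 0 := by
    intro i j
    fin_cases i <;> fin_cases j <;> simp [hzz, hww, hzw, hwz, hss, o1, o2, o3, o4, o1', o2', o3', o4']
  constructor
  · have := frob _ hon (adjMat G)
    rw [sq_sum_one G hG] at this
    simp [Fin.sum_univ_four, hz1, hz2, hw1, hw2, -neg_smul,
      smul_dotProduct, dotProduct_smul, smul_eq_mul, hss, hzz, hww] at this
    nlinarith
  · have := frob _ hon (adjMat G * adjMat G)
    have h3 := sq_entry_sum G hG
    simp [Fin.sum_univ_four, ← mulVec_mulVec, mulVec_smul, hz1, hz2, hw1, hw2, -neg_smul,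
      smul_dotProduct, dotProduct_smul, smul_eq_mul, hss, hzz, hww] at this
    nlinarith

lemma tree_of_conn_sum {n : ℕ} (G : SimpleGraph (Fin n)) (hG : G.Connected)
    (h : ∑ i, ∑ j, adjMat G i j ≤ 2 * ((n : ℝ) - 1)) : G.IsTree := by
  rw [SimpleGraph.isTree_iff_connected_and_card]
  refine ⟨hG, ?_⟩
  have h1 := hG.card_vert_le_card_edgeSet_add_one
  have h2 := G.sum_degrees_eq_twice_card_edges
  have h3 : ∑ i, ∑ j, adjMat G i j = ((2 * G.edgeFinset.card : ℕ) : ℝ) := by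
    rw [← h2]
    push_cast
    exact Finset.sum_congr rfl fun i _ => by rw [adj_row_sum, deg_eq_degree]
  have h4 : Nat.card G.edgeSet = G.edgeFinset.card := by
    rw [Nat.card_eq_fintype_card, SimpleGraph.edgeFinset_card]
  rw [h3] at h
  have h5 : G.edgeFinset.card + 1 ≤ n := by
    have : (G.edgeFinset.card : ℝ) + 1 ≤ n := by push_cast at h; linarith
    exact_mod_cast this
  rw [h4] at h1 ⊢
  rw [Nat.card_eq_fintype_card, Fintype.card_fin] at h1 ⊢
  omega

open Matrix in
lemma star_vec {n : ℕ} (G : SimpleGraph (Fin n)) (u : Fin n) (L : Finset (Fin n))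
    (hL : ∀ i ∈ L, G.Adj u i) (hk : 0 < L.card) :
    ∃ f : Fin n → ℝ, f ⬝ᵥ f = 1 ∧ √(L.card : ℝ) ≤ f ⬝ᵥ (adjMat G *ᵥ f) ∧
      ∀ i, i ≠ u → i ∉ L → f i = 0 := by
  have hu : u ∉ L := fun h => (hL u h).ne rfl
  have hk' : (0:ℝ) < L.card := by exact_mod_cast hk
  set k : ℝ := (L.card : ℝ) with hkdef
  let a : ℝ := √(1 / 2)
  let b : ℝ := √(1 / (2 * k))
  have ha : a * a = 1 / 2 := Real.mul_self_sqrt (by norm_num)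
  have hb : b * b = 1 / (2 * k) := Real.mul_self_sqrt (by positivity)
  have ha0 : 0 ≤ a := Real.sqrt_nonneg _
  have hb0 : 0 ≤ b := Real.sqrt_nonneg _
  let f : Fin n → ℝ := fun i => a * (if i = u then 1 else 0) + b * (if i ∈ L then 1 else 0)
  have hdot : ∀ h : Fin n → ℝ, f ⬝ᵥ h = a * h u + b * ∑ i ∈ L, h i := by
    intro h
    simp [f, dotProduct, add_mul, Finset.sum_add_distrib, Finset.mul_sum]
  have hfu : f u = a := by simp [f, hu]
  have hfL : ∀ i ∈ L, f i = b := by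
    intro i hi
    have : i ≠ u := fun h => hu (h ▸ hi)
    simp [f, hi, this]
  have hsumL : ∑ i ∈ L, f i = k * b := by
    rw [Finset.sum_congr rfl hfL]; simp [hkdef]
  refine ⟨f, ?_, ?_, ?_⟩
  · rw [hdot, hfu, hsumL]
    have : b * (k * b) = k * (b * b) := by ring
    rw [this, ha, hb]; field_simp; norm_num
  · rw [hdot]
    have hf0 : ∀ i, 0 ≤ f i := by
      intro i; simp only [f]; positivity
    have hA0 : ∀ i j, 0 ≤ adjMat G i j := by
      intro i j; unfold adjMat; split_ifs <;> simp
    have h1 : k * b ≤ (adjMat G *ᵥ f) u := by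
      rw [← hsumL]
      simp only [mulVec, dotProduct]
      calc _ = ∑ i ∈ L, adjMat G u i * f i :=
            Finset.sum_congr rfl fun i hi => by simp [adjMat, hL i hi]
        _ ≤ _ := Finset.sum_le_sum_of_subset_of_nonneg (Finset.subset_univ _)
            fun i _ _ => mul_nonneg (hA0 _ _) (hf0 _)
    have h2 : ∀ i ∈ L, a ≤ (adjMat G *ᵥ f) i := by
      intro i hi
      simp only [mulVec, dotProduct]
      calc a = adjMat G i u * f u := by simp [adjMat, (hL i hi).symm, hfu]
        _ ≤ _ := Finset.single_le_sum (f := fun j => adjMat G i j * f j)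
            (fun j _ => mul_nonneg (hA0 _ _) (hf0 _)) (Finset.mem_univ u)
    have h3 : k * a ≤ ∑ i ∈ L, (adjMat G *ᵥ f) i := by
      have := Finset.card_nsmul_le_sum L _ _ h2
      simpa [hkdef] using this
    have h4 : √k = 2 * k * (a * b) := by
      rw [Real.sqrt_eq_iff_mul_self_eq hk'.le (by positivity)]
      have : 2 * k * (a * b) * (2 * k * (a * b)) = 4 * k ^ 2 * (a * a) * (b * b) := by ring
      rw [this, ha, hb]; field_simp; norm_num
    rw [h4]
    nlinarith [mul_le_mul_of_nonneg_left h1 ha0, mul_le_mul_of_nonneg_left h3 hb0]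
  · intro i h1 h2
    simp [f, h1, h2]

lemma deg_le_lam {n : ℕ} (hn : 2 ≤ n) (G : SimpleGraph (Fin n)) (v : Fin n) (h0 : 0 ≤ lam 1 G) :
    (deg G v : ℝ) ≤ lam 1 G ^ 2 := by
  rcases Nat.eq_zero_or_pos (deg G v) with h | h
  · rw [h]; push_cast; positivity
  obtain ⟨f, h1, h2, h3⟩ := star_vec G v (Finset.univ.filter (fun w => G.Adj v w)) (by simp) h
  have := kyfan hn G 1 0 1 le_rfl one_pos f f h1 h1 h1
  simp at this
  have h4 : √(deg G v : ℝ) ≤ lam 1 G := h2.trans this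
  rwa [Real.sqrt_le_left h0] at h4

lemma parent_tree {n : ℕ} (hn : 0 < n) (G : SimpleGraph (Fin n)) (p : Fin n → Fin n)
    (hp : ∀ i : Fin n, i.val ≠ 0 → (p i).val < i.val)
    (hG : ∀ i j, G.Adj i j ↔ (i.val ≠ 0 ∧ p i = j) ∨ (j.val ≠ 0 ∧ p j = i)) : G.IsTree := by
  apply tree_of_conn_sum
  · have hr : ∀ m : ℕ, ∀ i : Fin n, i.val = m → G.Reachable i ⟨0, hn⟩ := by
      intro m
      induction m using Nat.strong_induction_on with
      | _ m ih =>
        intro i hi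
        by_cases h0 : i.val = 0
        · have : i = ⟨0, hn⟩ := Fin.ext h0
          rw [this]
        · have hadj : G.Adj i (p i) := (hG _ _).mpr (Or.inl ⟨h0, rfl⟩)
          exact hadj.reachable.trans (ih _ (by rw [← hi]; exact hp i h0) (p i) rfl)
    have : Nonempty (Fin n) := ⟨⟨0, hn⟩⟩
    exact ⟨fun i j => (hr _ i rfl).trans (hr _ j rfl).symm⟩
  · have hle : ∀ i j, adjMat G i j ≤ (if i.val ≠ 0 then (if p i = j then 1 else 0) else 0) +
        (if j.val ≠ 0 then (if p j = i then (1:ℝ) else 0) else 0) := by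
      intro i j
      unfold adjMat
      split_ifs with h <;> simp
      rename_i h1 h2 h3
      all_goals
        rw [hG] at h
        tauto
    have hcount : ∑ i : Fin n, (if i.val ≠ 0 then (1:ℝ) else 0) = n - 1 := by
      obtain ⟨m, rfl⟩ : ∃ m, n = m + 1 := ⟨n - 1, by omega⟩
      rw [Fin.sum_univ_succ]
      simp
    calc _ ≤ ∑ i, ∑ j, ((if i.val ≠ 0 then (if p i = j then 1 else 0) else 0) +
        (if j.val ≠ 0 then (if p j = i then (1:ℝ) else 0) else 0)) :=
          Finset.sum_le_sum fun i _ => Finset.sum_le_sum fun j _ => hle i j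
      _ = ∑ i : Fin n, (if i.val ≠ 0 then (1:ℝ) else 0) + ∑ i : Fin n, (if i.val ≠ 0 then (1:ℝ) else 0) := by
          simp only [Finset.sum_add_distrib]
          congr 1
          · refine Finset.sum_congr rfl fun i _ => ?_
            split_ifs <;> simp
          · rw [Finset.sum_comm]
            refine Finset.sum_congr rfl fun i _ => ?_
            split_ifs <;> simp
      _ ≤ _ := by rw [hcount]; linarith

lemma dstar_exists (n k : ℕ) (hk : 1 ≤ k) (hkn : k + 3 ≤ n) :
    ∃ T : SimpleGraph (Fin n), T.IsTree ∧ ∀ α β : ℝ, 0 ≤ β → β < α →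
      α * √(k : ℝ) + β * √((n - 2 - k : ℕ) : ℝ) ≤ α * lam 1 T + β * lam 2 T := by
  let z0 : Fin n := ⟨0, by omega⟩
  let z1 : Fin n := ⟨1, by omega⟩
  let p : Fin n → Fin n := fun i => if i.val < k + 2 then z0 else z1
  have hp : ∀ i : Fin n, i.val ≠ 0 → (p i).val < i.val := by
    intro i hi
    simp only [p, z0, z1]
    split_ifs <;> simp <;> omega
  let G : SimpleGraph (Fin n) :=
    { Adj := fun i j => (i.val ≠ 0 ∧ p i = j) ∨ (j.val ≠ 0 ∧ p j = i)
      symm := ⟨fun i j h => h.symm⟩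
      loopless := ⟨fun i h => by
        have : i.val ≠ 0 ∧ p i = i := by tauto
        have h2 := hp i this.1
        rw [this.2] at h2
        omega⟩ }
  refine ⟨G, parent_tree (by omega) G p hp (fun i j => Iff.rfl), fun α β hβ hαβ => ?_⟩
  let L1 : Finset (Fin n) := Finset.univ.filter (fun i => 2 ≤ i.val ∧ i.val < k + 2)
  let L2 : Finset (Fin n) := Finset.univ.filter (fun i => k + 2 ≤ i.val)
  have c1 : L1.card = k := by
    have : L1.card = (Finset.Ico 2 (k + 2)).card := by
      rw [← Finset.card_map Fin.valEmbedding]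
      congr 1
      ext x
      simp only [L1, Finset.mem_map, Finset.mem_filter, Finset.mem_univ, true_and, Fin.valEmbedding_apply, Finset.mem_Ico]
      exact ⟨fun ⟨a, h, e⟩ => by omega, fun h => ⟨⟨x, by omega⟩, h, rfl⟩⟩
    rw [this]; simp
  have c2 : L2.card = n - 2 - k := by
    have : L2.card = (Finset.Ico (k + 2) n).card := by
      rw [← Finset.card_map Fin.valEmbedding]
      congr 1
      ext x
      simp only [L2, Finset.mem_map, Finset.mem_filter, Finset.mem_univ, true_and, Fin.valEmbedding_apply, Finset.mem_Ico]
      exact ⟨fun ⟨a, h, e⟩ => by omega, fun h => ⟨⟨x, by omega⟩, h.1, rfl⟩⟩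
    rw [this]; simp; omega
  obtain ⟨f, hf1, hf2, hf3⟩ := star_vec G z0 L1 (by
    intro i hi
    simp only [L1, Finset.mem_filter, Finset.mem_univ, true_and] at hi
    right
    refine ⟨by omega, ?_⟩
    simp only [p, if_pos hi.2]) (by omega)
  obtain ⟨g, hg1, hg2, hg3⟩ := star_vec G z1 L2 (by
    intro i hi
    simp only [L2, Finset.mem_filter, Finset.mem_univ, true_and] at hi
    right
    refine ⟨by omega, ?_⟩
    simp only [p, if_neg (not_lt.mpr hi)]) (by omega)
  have hfg : f ⬝ᵥ g = 0 := by
    rw [dotProduct]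
    refine Finset.sum_eq_zero fun i _ => ?_
    by_cases h : i = z0 ∨ i ∈ L1
    · rw [hg3 i, mul_zero]
      · rintro rfl
        simp [z0, z1, L1, Fin.ext_iff] at h
      · intro h2
        simp only [L1, L2, z0, Finset.mem_filter, Finset.mem_univ, true_and, Fin.ext_iff] at h h2
        omega
    · push Not at h
      rw [hf3 i h.1 h.2, zero_mul]
  have := kyfan (by omega) G α β 0 hβ hαβ f g hf1 hg1 hfg
  rw [c1] at hf2
  rw [c2] at hg2
  have h5 := mul_le_mul_of_nonneg_left hf2 (by linarith : 0 ≤ α)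
  have h6 := mul_le_mul_of_nonneg_left hg2 hβ
  simp at this
  linarith

open Matrix in
lemma leaf_move {n : ℕ} (G : SimpleGraph (Fin n)) (hG : G.IsTree) (l p q : Fin n)
    (hlp : G.Adj l p) (hd : deg G l = 1) (hql : q ≠ l) :
    ∃ T : SimpleGraph (Fin n), T.IsTree ∧ ∀ f : Fin n → ℝ,
      f ⬝ᵥ (adjMat T *ᵥ f) = f ⬝ᵥ (adjMat G *ᵥ f) - 2 * f l * f p + 2 * f l * f q := by
  have hd' : G.degree l = 1 := by rw [← deg_eq_degree]; exact hd
  have huniq : ∀ j, G.Adj l j → j = p := by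
    intro j hj
    obtain ⟨w, hw, hw2⟩ := SimpleGraph.degree_eq_one_iff_existsUnique_adj.mp hd'
    rw [hw2 j hj, hw2 p hlp]
  let T : SimpleGraph (Fin n) :=
    { Adj := fun i j => (i ≠ l ∧ j ≠ l ∧ G.Adj i j) ∨ (i = l ∧ j = q) ∨ (i = q ∧ j = l)
      symm := ⟨fun i j h => by
        rcases h with ⟨h1, h2, h3⟩ | ⟨h1, h2⟩ | ⟨h1, h2⟩
        · exact Or.inl ⟨h2, h1, h3.symm⟩
        · exact Or.inr (Or.inr ⟨h2, h1⟩)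
        · exact Or.inr (Or.inl ⟨h2, h1⟩)⟩
      loopless := ⟨fun i h => by
        rcases h with ⟨h1, h2, h3⟩ | ⟨h1, h2⟩ | ⟨h1, h2⟩
        · exact h3.ne rfl
        · exact hql (h2.symm.trans h1)
        · exact hql (h1.symm.trans h2)⟩ }
  have hTadj : ∀ i j, T.Adj i j ↔
      (i ≠ l ∧ j ≠ l ∧ G.Adj i j) ∨ (i = l ∧ j = q) ∨ (i = q ∧ j = l) := fun _ _ => Iff.rfl
  have hpl : p ≠ l := hlp.ne.symm
  have hmat : ∀ i j, adjMat T i j = adjMat G i j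
      - (if i = l then (if j = p then 1 else 0) else 0) - (if j = l then (if i = p then 1 else 0) else 0)
      + (if i = l then (if j = q then 1 else 0) else 0) + (if j = l then (if i = q then 1 else 0) else 0) := by
    intro i j
    have e1 : adjMat T i j = if (i ≠ l ∧ j ≠ l ∧ G.Adj i j) ∨ (i = l ∧ j = q) ∨ (i = q ∧ j = l)
      then 1 else 0 := by simp only [adjMat, hTadj]
    rw [e1]
    unfold adjMat
    by_cases hi : i = l
    · subst hi
      have : G.Adj i j ↔ j = p := ⟨huniq j, fun h => h ▸ hlp⟩
      by_cases hj : j = i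
      · subst hj
        simp [hql, hpl.symm, hql.symm]
      · by_cases hjp : j = p <;> by_cases hjq : j = q <;> simp [this, hj, hjp, hjq]
        all_goals simp_all
    · by_cases hj : j = l
      · subst hj
        have : G.Adj i j ↔ i = p := ⟨fun h => huniq i h.symm, fun h => h ▸ hlp.symm⟩
        by_cases hjp : i = p <;> by_cases hjq : i = q <;> simp [this, hi, hjp, hjq]
        all_goals simp_all
      · simp [hi, hj]
  have hquad : ∀ f : Fin n → ℝ,
      f ⬝ᵥ (adjMat T *ᵥ f) = f ⬝ᵥ (adjMat G *ᵥ f) - 2 * f l * f p + 2 * f l * f q := by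
    intro f
    simp only [dotProduct, mulVec, hmat, add_mul, sub_mul, mul_add, mul_sub,
      Finset.sum_add_distrib, Finset.sum_sub_distrib, ite_mul, one_mul, zero_mul, mul_ite, mul_zero,
      Finset.sum_ite_eq, Finset.sum_ite_eq', Finset.mem_univ, if_true, Finset.sum_ite_irrel, Finset.sum_const_zero]
    ring
  refine ⟨T, ?_, hquad⟩
  apply tree_of_conn_sum
  · have hc := hG.connected.induce_compl_singleton_of_degree_eq_one hd'
    let φ : G.induce ({l}ᶜ : Set (Fin n)) →g T :=
      { toFun := fun x => x.1
        map_rel' := fun {a b} h => Or.inl ⟨a.2, b.2, h⟩ }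
    have hr : ∀ i, T.Reachable i q := by
      intro i
      by_cases hi : i = l
      · have : T.Adj i q := Or.inr (Or.inl ⟨hi, rfl⟩)
        exact this.reachable
      · have := hc.preconnected ⟨i, hi⟩ ⟨q, hql⟩
        exact this.map φ
    have : Nonempty (Fin n) := ⟨l⟩
    exact ⟨fun i j => (hr i).trans (hr j).symm⟩
  · have h1 := hquad (fun _ => 1)
    simp only [dotProduct, mulVec, one_mul, mul_one] at h1
    rw [h1]
    simp only [adj_row_sum]
    rw [sum_deg_tree G hG]
    linarith

open Matrix in
lemma lam_diff {n : ℕ} (hn : 2 ≤ n) (G : SimpleGraph (Fin n)) (hG : G.IsTree) :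
    0 ≤ lam 1 G - lam 2 G ∧ lam 1 G - lam 2 G ≤ 4 * √(n : ℝ) := by
  obtain ⟨v, l, hv, hl, hanti, hpars, h1, h2⟩ := spec hn G
  have hb : ∀ i, |l i| ≤ 2 * √(n : ℝ) := by
    intro i
    have := frob ![v i] (by intro a b; fin_cases a; fin_cases b; simp [hv]) (adjMat G)
    rw [sq_sum_one G hG] at this
    simp [hl, hv] at this
    apply abs_le_of_sq_le_sq _ (by positivity)
    rw [mul_pow, Real.sq_sqrt (by positivity)]
    nlinarith [(Nat.cast_nonneg n : (0:ℝ) ≤ n)]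
  have hle : l ⟨1, by omega⟩ ≤ l ⟨0, by omega⟩ := hanti (by simp [Fin.le_def])
  have a1 := abs_le.mp (hb ⟨0, by omega⟩)
  have a2 := abs_le.mp (hb ⟨1, by omega⟩)
  rw [h1, h2]
  constructor <;> linarith [a1.1, a1.2, a2.1, a2.2]

open Matrix in
lemma leaf_eig {n : ℕ} (G : SimpleGraph (Fin n)) (l p : Fin n)
    (hlp : G.Adj l p) (hd : deg G l = 1) (z : Fin n → ℝ) (x : ℝ)
    (hz : adjMat G *ᵥ z = x • z) : z p = x * z l := by
  have hd' : G.degree l = 1 := by rw [← deg_eq_degree]; exact hd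
  have huniq : ∀ j, G.Adj l j ↔ j = p := by
    intro j
    obtain ⟨w, hw, hw2⟩ := SimpleGraph.degree_eq_one_iff_existsUnique_adj.mp hd'
    exact ⟨fun hj => by rw [hw2 j hj, hw2 p hlp], fun h => h ▸ hlp⟩
  have := congrFun hz l
  simp only [mulVec, dotProduct, adjMat, huniq, Pi.smul_apply, smul_eq_mul] at this
  simpa using this

open Matrix in
lemma update_dot {n : ℕ} (z w : Fin n → ℝ) (l : Fin n) (a b : ℝ) :
    (z + (a - z l) • Pi.single l 1) ⬝ᵥ (w + (b - w l) • Pi.single l 1)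
      = z ⬝ᵥ w + a * b - z l * w l := by
  simp only [add_dotProduct, dotProduct_add, smul_dotProduct, dotProduct_smul, smul_eq_mul,
    single_one_dotProduct, dotProduct_single_one, Pi.add_apply, Pi.smul_apply,
    Pi.single_eq_same, mul_one]
  ring

open Matrix in
lemma update_quad {n : ℕ} (G : SimpleGraph (Fin n)) (z : Fin n → ℝ) (x : ℝ) (l : Fin n) (a : ℝ)
    (hz : adjMat G *ᵥ z = x • z) (hzz : z ⬝ᵥ z = 1) :
    (z + (a - z l) • Pi.single l 1) ⬝ᵥ (adjMat G *ᵥ (z + (a - z l) • Pi.single l 1))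
      = x + 2 * (a - z l) * (x * z l) := by
  have h1 : z ⬝ᵥ (adjMat G *ᵥ Pi.single l 1) = x * z l := by
    rw [adj_symm_dot, hz]
    simp
  have h2 : (adjMat G *ᵥ (Pi.single l 1 : Fin n → ℝ)) l = 0 := by
    simp [adjMat]
  rw [mulVec_add, mulVec_smul, hz]
  simp only [add_dotProduct, dotProduct_add, smul_dotProduct, dotProduct_smul, smul_eq_mul,
    single_one_dotProduct, h1, h2, hzz, Pi.smul_apply]
  ring

open Matrix in
lemma move_ineq {n : ℕ} (hn : 2 ≤ n) (G : SimpleGraph (Fin n)) (hG : G.IsTree) (l p q : Fin n)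
    (hlp : G.Adj l p) (hd : deg G l = 1) (hql : q ≠ l) (z w : Fin n → ℝ) (x y α β : ℝ)
    (hz : adjMat G *ᵥ z = x • z) (hw : adjMat G *ᵥ w = y • w)
    (hzz : z ⬝ᵥ z = 1) (hww : w ⬝ᵥ w = 1) (hzw : z ⬝ᵥ w = 0) (hx : x ≠ 0) (hy : y ≠ 0)
    (hβ : 0 ≤ β) (hαβ : β < α) (s t : ℝ)
    (hs : s = (z q ^ 2 - z p ^ 2) / x ^ 2) (ht : t = (w q ^ 2 - w p ^ 2) / y ^ 2)
    (hs0 : 0 < 1 + s) (ht0 : 0 < 1 + t) :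
    ∃ T : SimpleGraph (Fin n), T.IsTree ∧
      α * (x + x * s / (1 + s)) + β * (y + y * t / (1 + t)) ≤ α * lam 1 T + β * lam 2 T +
        4 * √(n : ℝ) * (α * β / (α - β) *
          ((z q * w q - z p * w p) ^ 2 / (x ^ 2 * y ^ 2 * (1 + s) * (1 + t)))) := by
  obtain ⟨T, hT, hquad⟩ := leaf_move G hG l p q hlp hd hql
  refine ⟨T, hT, ?_⟩
  have hpl : p ≠ l := hlp.ne.symm
  have ez := leaf_eig G l p hlp hd z x hz
  have ew := leaf_eig G l p hlp hd w y hw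
  set a := z q / x with ha
  set b := w q / y with hb
  have eza : z q = x * a := by rw [ha]; field_simp
  have ewb : w q = y * b := by rw [hb]; field_simp
  set f := z + (a - z l) • (Pi.single l 1 : Fin n → ℝ) with hf
  set g := w + (b - w l) • (Pi.single l 1 : Fin n → ℝ) with hg
  have hs' : s = a ^ 2 - z l ^ 2 := by rw [hs, ez, eza]; field_simp
  have ht' : t = b ^ 2 - w l ^ 2 := by rw [ht, ew, ewb]; field_simp
  have ff : f ⬝ᵥ f = 1 + s := by rw [hf, update_dot, hzz, hs']; ring
  have gg : g ⬝ᵥ g = 1 + t := by rw [hg, update_dot, hww, ht']; ring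
  have fg : f ⬝ᵥ g = a * b - z l * w l := by rw [hf, hg, update_dot, hzw]; ring
  have fl : f l = a := by simp [hf]
  have fp : f p = z p := by simp [hf, hpl]
  have fq : f q = z q := by simp [hf, hql]
  have gl : g l = b := by simp [hg]
  have gp : g p = w p := by simp [hg, hpl]
  have gq : g q = w q := by simp [hg, hql]
  have fA : f ⬝ᵥ (adjMat T *ᵥ f) = x * (1 + 2 * s) := by
    rw [hquad, fl, fp, fq, hf, update_quad G z x l a hz hzz, hs', ez, eza]; ring
  have gA : g ⬝ᵥ (adjMat T *ᵥ g) = y * (1 + 2 * t) := by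
    rw [hquad, gl, gp, gq, hg, update_quad G w y l b hw hww, ht', ew, ewb]; ring
  have s1 : √(1 + s) ≠ 0 := (Real.sqrt_pos.mpr hs0).ne'
  have s2 : √(1 + t) ≠ 0 := (Real.sqrt_pos.mpr ht0).ne'
  have q1 : √(1 + s) * √(1 + s) = 1 + s := Real.mul_self_sqrt hs0.le
  have q2 : √(1 + t) * √(1 + t) = 1 + t := Real.mul_self_sqrt ht0.le
  have hmain := kyfan hn T α β ((a * b - z l * w l) / (√(1 + s) * √(1 + t))) hβ hαβ
    ((√(1 + s))⁻¹ • f) ((√(1 + t))⁻¹ • g)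
    (by rw [smul_dotProduct, dotProduct_smul, ff, smul_eq_mul, smul_eq_mul, ← mul_assoc, ← mul_inv, q1]
        exact inv_mul_cancel₀ hs0.ne')
    (by rw [smul_dotProduct, dotProduct_smul, gg, smul_eq_mul, smul_eq_mul, ← mul_assoc, ← mul_inv, q2]
        exact inv_mul_cancel₀ ht0.ne')
    (by rw [smul_dotProduct, dotProduct_smul, fg, smul_eq_mul, smul_eq_mul]; field_simp)
  rw [mulVec_smul, mulVec_smul, smul_dotProduct, dotProduct_smul, smul_dotProduct, dotProduct_smul,
    fA, gA] at hmain
  simp only [smul_eq_mul] at hmain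
  rw [← mul_assoc (√(1 + s))⁻¹, ← mul_inv, q1, ← mul_assoc (√(1 + t))⁻¹, ← mul_inv, q2] at hmain
  have e1 : (1 + s)⁻¹ * (x * (1 + 2 * s)) = x + x * s / (1 + s) := by field_simp; ring
  have e2 : (1 + t)⁻¹ * (y * (1 + 2 * t)) = y + y * t / (1 + t) := by field_simp; ring
  have e3 : ((a * b - z l * w l) / (√(1 + s) * √(1 + t))) ^ 2 =
      (z q * w q - z p * w p) ^ 2 / (x ^ 2 * y ^ 2 * (1 + s) * (1 + t)) := by
    rw [div_pow, mul_pow, Real.sq_sqrt hs0.le, Real.sq_sqrt ht0.le, ez, eza, ew, ewb]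
    field_simp
  rw [e1, e2, e3] at hmain
  refine hmain.trans ?_
  have hl := lam_diff hn T hT
  have : 0 ≤ α * β / (α - β) *
          ((z q * w q - z p * w p) ^ 2 / (x ^ 2 * y ^ 2 * (1 + s) * (1 + t))) := by
    have h1 : 0 ≤ α := by linarith
    have h2 : 0 ≤ α - β := by linarith
    positivity
  have := mul_le_mul_of_nonneg_right hl.2 this
  linarith

lemma psi_lower (α β : ℝ) (hβ : 0 < β) (hβα : β < α) :
    ∃ N : ℕ, ∀ n : ℕ, N ≤ n → ∃ T : SimpleGraph (Fin n), T.IsTree ∧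
      0 < α * lam 1 T + β * lam 2 T ∧
      (α ^ 2 + β ^ 2) * (n - 2) - (α ^ 2 + β ^ 2) ^ 2 / β ^ 2 ≤ (α * lam 1 T + β * lam 2 T) ^ 2 := by
  have hα : 0 < α := hβ.trans hβα
  set q := α ^ 2 + β ^ 2 with hq
  have hq0 : 0 < q := by positivity
  set t := α ^ 2 / q with ht
  have ht0 : 0 < t := by positivity
  have htq : t * q = α ^ 2 := by rw [ht]; field_simp
  have ht1 : 0 < 1 - t := by
    rw [ht, sub_pos, div_lt_one hq0]; nlinarith [sq_nonneg β, mul_pos hβ hβ]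
  obtain ⟨N, hN⟩ := exists_nat_gt (1 / t + 1 / (1 - t) + 2)
  refine ⟨N, fun n hn => ?_⟩
  have hnN : (N : ℝ) ≤ n := by exact_mod_cast hn
  have p1 : 0 < 1 / t := by positivity
  have p2 : 0 < 1 / (1 - t) := by positivity
  have hn1 : 1 < t * ((n : ℝ) - 2) := by
    have : 1 / t < (n : ℝ) - 2 := by linarith
    rw [div_lt_iff₀ ht0] at this; linarith
  have hn2 : 1 < (1 - t) * ((n : ℝ) - 2) := by
    have : 1 / (1 - t) < (n : ℝ) - 2 := by linarith
    rw [div_lt_iff₀ ht1] at this; linarith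
  have hn0 : (0 : ℝ) ≤ t * ((n : ℝ) - 2) := by linarith
  set k := ⌊t * ((n : ℝ) - 2)⌋₊ with hk
  have k1 : (k : ℝ) ≤ t * ((n : ℝ) - 2) := Nat.floor_le hn0
  have k2 : t * ((n : ℝ) - 2) < k + 1 := Nat.lt_floor_add_one _
  have hk1 : 1 ≤ k := by
    rw [hk]; exact Nat.le_floor (by push_cast; linarith)
  have hkn : k + 3 ≤ n := by
    have : (k : ℝ) + 3 < n := by nlinarith
    have h3 : k + 3 < n := by exact_mod_cast this
    omega
  obtain ⟨T, hT, hTb⟩ := dstar_exists n k hk1 hkn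
  refine ⟨T, hT, ?_⟩
  have hb := hTb α β hβ.le hβα
  have hm : ((n - 2 - k : ℕ) : ℝ) = (n : ℝ) - 2 - k := by
    rw [Nat.cast_sub (by omega), Nat.cast_sub (by omega)]; norm_num
  rw [hm] at hb
  have hk1' : (1 : ℝ) ≤ k := by exact_mod_cast hk1
  have hm0 : 0 ≤ (n : ℝ) - 2 - k := by
    have : ((k + 3 : ℕ) : ℝ) ≤ n := by exact_mod_cast hkn
    push_cast at this; linarith
  set a := √(k : ℝ) with ha
  set b := √((n : ℝ) - 2 - k) with hbd
  have ha2 : a ^ 2 = k := Real.sq_sqrt (by linarith)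
  have hb2 : b ^ 2 = (n : ℝ) - 2 - k := Real.sq_sqrt hm0
  have ha0 : 1 ≤ a := by rw [ha]; exact Real.one_le_sqrt.mpr hk1'
  have hb0 : 0 ≤ b := Real.sqrt_nonneg _
  have hpos : 0 < α * a + β * b := by positivity
  refine ⟨lt_of_lt_of_le hpos hb, ?_⟩
  have hdiff : (β * a - α * b) ^ 2 ≤ q ^ 2 / β ^ 2 := by
    rw [le_div_iff₀ (by positivity)]
    have e : β ^ 2 * a ^ 2 - α ^ 2 * b ^ 2 = q * (k - t * ((n : ℝ) - 2)) := by
      rw [ha2, hb2]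
      have : q * (k - t * ((n : ℝ) - 2)) = q * k - (t * q) * ((n : ℝ) - 2) := by ring
      rw [this, htq, hq]; ring
    have e2 : (β ^ 2 * a ^ 2 - α ^ 2 * b ^ 2) ^ 2 ≤ q ^ 2 := by
      rw [e, mul_pow]
      have : (k - t * ((n : ℝ) - 2)) ^ 2 ≤ 1 := by
        rw [sq_le_one_iff_abs_le_one, abs_le]; constructor <;> linarith
      nlinarith [sq_nonneg q]
    have e3 : (β ^ 2 * a ^ 2 - α ^ 2 * b ^ 2) ^ 2 = (β * a - α * b) ^ 2 * (β * a + α * b) ^ 2 := by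
      ring
    have e4 : β ^ 2 ≤ (β * a + α * b) ^ 2 := by
      apply pow_le_pow_left₀ hβ.le
      nlinarith [mul_nonneg hα.le hb0]
    calc _ ≤ (β * a - α * b) ^ 2 * (β * a + α * b) ^ 2 :=
          mul_le_mul_of_nonneg_left e4 (sq_nonneg _)
      _ ≤ _ := by rw [← e3]; exact e2
  have h2 : (α * a + β * b) ^ 2 = q * ((n : ℝ) - 2) - (β * a - α * b) ^ 2 := by
    have : (α * a + β * b) ^ 2 = q * (a ^ 2 + b ^ 2) - (β * a - α * b) ^ 2 := by rw [hq]; ring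
    rw [this, ha2, hb2]; ring
  have h3 := pow_le_pow_left₀ hpos.le hb 2
  linarith

/-- `IsMax`-type predicate used throughout. -/
def PsiMax {n : ℕ} (α β : ℝ) (G : SimpleGraph (Fin n)) : Prop :=
  G.IsTree ∧ ∀ T : SimpleGraph (Fin n), T.IsTree →
    α * lam 1 T + β * lam 2 T ≤ α * lam 1 G + β * lam 2 G

lemma first_order (α β : ℝ) (hβ : 0 < β) (hβα : β < α) (hab : α + β = 1) :
    ∃ C : ℝ, 0 < C ∧ ∃ N : ℕ, 2 ≤ N ∧ ∀ n : ℕ, N ≤ n → ∀ G : SimpleGraph (Fin n), PsiMax α β G →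
      0 < lam 2 G ∧ lam 2 G ≤ lam 1 G ∧ lam 1 G ^ 2 + lam 2 G ^ 2 ≤ n - 1 ∧
      n - C ≤ lam 1 G ^ 2 + lam 2 G ^ 2 ∧ |β * lam 1 G - α * lam 2 G| ≤ C := by
  have hα : 0 < α := hβ.trans hβα
  obtain ⟨N, hN⟩ := psi_lower α β hβ hβα
  set q := α ^ 2 + β ^ 2 with hq
  have hq0 : 0 < q := by positivity
  set D := 2 * q + q ^ 2 / β ^ 2 with hD
  have hD0 : 0 < D := by positivity
  obtain ⟨N2, hN2⟩ := exists_nat_gt (D / β ^ 2)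
  refine ⟨1 + D + D / q, by positivity, max (max N N2) 2, le_max_right _ _, fun n hn G hG => ?_⟩
  have hn1 : N ≤ n := le_trans (le_trans (le_max_left _ _) (le_max_left _ _)) hn
  have hn2 : N2 ≤ n := le_trans (le_trans (le_max_right _ _) (le_max_left _ _)) hn
  have hn3 : 2 ≤ n := le_trans (le_max_right _ _) hn
  have hN2n : D / β ^ 2 < n := lt_of_lt_of_le hN2 (by exact_mod_cast hn2)
  rw [div_lt_iff₀ (by positivity)] at hN2n
  obtain ⟨T, hT, hpos, hlow⟩ := hN n hn1
  have hle := hG.2 T hT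
  have hlow2 : q * n - D ≤ (α * lam 1 G + β * lam 2 G) ^ 2 := by
    have := pow_le_pow_left₀ hpos.le hle 2
    rw [hD]; linarith
  have hP := lt_of_lt_of_le hpos hle
  have hyx : lam 2 G ≤ lam 1 G := by linarith [(lam_diff hn3 G hG.1).1]
  generalize hx : lam 1 G = x at *
  generalize hy : lam 2 G = y at *
  have hx0 : 0 < x := by
    by_contra h
    have : α * x + β * y ≤ 0 := by nlinarith
    linarith
  have hX : x ^ 2 ≤ n - 1 := by rw [← hx]; exact lam1_sq_le hn3 G hG.1 (by rw [hx]; exact hx0)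
  have hy0 : 0 < y := by
    by_contra h
    have h1 : α * x + β * y ≤ α * x := by nlinarith
    have h2 := pow_le_pow_left₀ hP.le h1 2
    have h3 : (α * x) ^ 2 ≤ α ^ 2 * n := by nlinarith [sq_nonneg α]
    nlinarith
  have hXY : x ^ 2 + y ^ 2 ≤ n - 1 := by
    rw [← hx, ← hy]; exact (lam12_bounds hn3 G hG.1 (by rw [hy]; exact hy0)).1
  have hid : (β * x - α * y) ^ 2 = q * (x ^ 2 + y ^ 2) - (α * x + β * y) ^ 2 := by rw [hq]; ring
  have hDq : 0 < D / q := by positivity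
  refine ⟨hy0, hyx, hXY, ?_, ?_⟩
  · have : (n : ℝ) - D / q ≤ x ^ 2 + y ^ 2 := by
      have h1 : q * n - D ≤ q * (x ^ 2 + y ^ 2) := by nlinarith [sq_nonneg (β * x - α * y)]
      have h2 : D = q * (D / q) := by field_simp
      rw [h2, ← mul_sub] at h1
      exact le_of_mul_le_mul_left h1 hq0
    linarith
  · have h1 : (β * x - α * y) ^ 2 ≤ D := by nlinarith
    have h2 : |β * x - α * y| ≤ 1 + D := by
      apply abs_le_of_sq_le_sq _ (by positivity)
      nlinarith
    linarith

lemma gap_bounds (α β : ℝ) (hβ : 0 < β) (hβα : β < α) (C : ℝ) (hC : 0 < C) :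
    ∃ κ : ℝ, 0 < κ ∧ κ < 1 ∧ ∃ N : ℕ, ∀ n : ℕ, N ≤ n → ∀ x y : ℝ, 0 < y → y ≤ x →
      x ^ 2 + y ^ 2 ≤ n - 1 → n - C ≤ x ^ 2 + y ^ 2 → |β * x - α * y| ≤ C →
      κ * n ≤ y ^ 2 ∧ y ^ 2 ≤ (1 / 2 - κ) * n ∧ (1 / 2 + κ) * n ≤ x ^ 2 := by
  have hα : 0 < α := hβ.trans hβα
  set q := α ^ 2 + β ^ 2 with hq
  have hq0 : 0 < q := by positivity
  have hαβ : 0 < α ^ 2 - β ^ 2 := by nlinarith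
  -- κ
  set κ := min ((α ^ 2 - β ^ 2) / (4 * q)) (β ^ 2 / (4 * q)) with hκ
  have k0 : 0 < κ := lt_min (by positivity) (by positivity)
  have k1 : κ * (4 * q) ≤ α ^ 2 - β ^ 2 := by
    rw [← le_div_iff₀ (by positivity)]; exact min_le_left _ _
  have k2 : κ * (4 * q) ≤ β ^ 2 := by
    rw [← le_div_iff₀ (by positivity)]; exact min_le_right _ _
  have k3 : κ < 1 := by
    by_contra h
    have : q * 4 ≤ κ * (4 * q) := by nlinarith
    nlinarith [mul_pos hα hα, mul_pos hβ hβ]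
  -- threshold: (α+β) * C * √n + q*C ≤ κ q n
  obtain ⟨N, hN⟩ := exists_nat_gt (((((α + β) * C + q * C) / (κ * q)) ^ 2) + 1)
  refine ⟨κ, k0, k3, N, fun n hn x y hy hyx h1 h2 h3 => ?_⟩
  have hnN : (N : ℝ) ≤ n := by exact_mod_cast hn
  set R := √(n : ℝ) with hR
  have hn0 : (0 : ℝ) ≤ n := Nat.cast_nonneg n
  have R2 : R ^ 2 = n := Real.sq_sqrt hn0
  have sq1 := sq_nonneg (((α + β) * C + q * C) / (κ * q))
  have R1 : 1 ≤ R := by rw [hR]; exact Real.one_le_sqrt.mpr (by linarith)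
  have RB : ((α + β) * C + q * C) / (κ * q) ≤ R := by
    rw [hR]; apply Real.le_sqrt_of_sq_le; linarith
  rw [div_le_iff₀ (by positivity)] at RB
  have hx0 : 0 < x := lt_of_lt_of_le hy hyx
  have xR : x ≤ R := by
    rw [hR]; apply Real.le_sqrt_of_sq_le; linarith [sq_nonneg y]
  have yR : y ≤ R := hyx.trans xR
  have key : |β ^ 2 * x ^ 2 - α ^ 2 * y ^ 2| ≤ C * ((α + β) * R) := by
    have : β ^ 2 * x ^ 2 - α ^ 2 * y ^ 2 = (β * x - α * y) * (β * x + α * y) := by ring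
    rw [this, abs_mul, abs_of_pos (by positivity : 0 < β * x + α * y)]
    apply mul_le_mul h3 _ (by positivity) hC.le
    have i1 := mul_le_mul_of_nonneg_left xR hβ.le
    have i2 := mul_le_mul_of_nonneg_left yR hα.le
    linarith
  have bound : C * ((α + β) * R) + q * C ≤ κ * q * n := by
    rw [← R2]
    have i1 : q * C * 1 ≤ q * C * R := mul_le_mul_of_nonneg_left R1 (by positivity)
    have i2 := mul_le_mul_of_nonneg_right RB (by linarith : (0 : ℝ) ≤ R)
    have i3 : R * (κ * q) * R = κ * q * R ^ 2 := by ring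
    have i4 : ((α + β) * C + q * C) * R = C * ((α + β) * R) + q * C * R := by ring
    linarith
  obtain ⟨l1, l2⟩ := abs_le.mp key
  set X := x ^ 2
  set Y := y ^ 2
  have eX : q * X = α ^ 2 * (X + Y) + (β ^ 2 * X - α ^ 2 * Y) := by rw [hq]; ring
  have eY : q * Y = β ^ 2 * (X + Y) - (β ^ 2 * X - α ^ 2 * Y) := by rw [hq]; ring
  have a1 : α ^ 2 * (n - C) ≤ α ^ 2 * (X + Y) := mul_le_mul_of_nonneg_left h2 (sq_nonneg _)
  have b1 : β ^ 2 * (n - C) ≤ β ^ 2 * (X + Y) := mul_le_mul_of_nonneg_left h2 (sq_nonneg _)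
  have b2 : β ^ 2 * (X + Y) ≤ β ^ 2 * n := mul_le_mul_of_nonneg_left (by linarith) (sq_nonneg _)
  have qa : α ^ 2 * C ≤ q * C :=
    mul_le_mul_of_nonneg_right (by rw [hq]; linarith [sq_nonneg β]) hC.le
  have qb : β ^ 2 * C ≤ q * C :=
    mul_le_mul_of_nonneg_right (by rw [hq]; linarith [sq_nonneg α]) hC.le
  have c1 : κ * (4 * q) * n ≤ (α ^ 2 - β ^ 2) * n := mul_le_mul_of_nonneg_right k1 hn0
  have c2 : κ * (4 * q) * n ≤ β ^ 2 * n := mul_le_mul_of_nonneg_right k2 hn0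
  have hp : 0 ≤ κ * q * n := by positivity
  have hqC : 0 < q * C := by positivity
  have qn : q * n = α ^ 2 * n + β ^ 2 * n := by rw [hq]; ring
  refine ⟨?_, ?_, ?_⟩
  · apply le_of_mul_le_mul_left _ hq0
    linarith
  · apply le_of_mul_le_mul_left _ hq0
    linarith
  · apply le_of_mul_le_mul_left _ hq0
    linarith

lemma degs_real (C κ n C3 C4 C5 X Y M E1 E2 Q QQ : ℝ) (hC : 0 < C) (hκ : 0 < κ) (hκ1 : κ < 1)
    (hC3 : C3 = (2 + 2 * C + C ^ 2) / κ) (hC4 : C4 = C3 + C) (hC5 : C5 = C4 + 2 / κ)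
    (hn4 : 4 ≤ n) (t1 : C + 2 ≤ 2 * κ ^ 2 * n) (t2 : 2 * C ≤ κ * n)
    (h1 : X + Y ≤ n - 1) (h2 : n - C ≤ X + Y) (h3 : κ * n ≤ Y) (h4 : Y ≤ (1 / 2 - κ) * n)
    (h5 : (1 / 2 + κ) * n ≤ X) (es2 : X ^ 2 + Y ^ 2 - 2 * n + 3 ≤ QQ)
    (eM : E1 + M = n - 2) (M0 : 0 ≤ M) (S1 : QQ ≤ E1 * (n - 2)) (S2 : QQ = E1 ^ 2 + Q)
    (S3 : Q ≤ M ^ 2) (S4 : Q ≤ E2 * M) (S5 : E2 ≤ M) (eX : E1 + 1 ≤ X) (z1 : 0 ≤ E1)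
    (z2 : 0 ≤ E2) :
    |E1 + 1 - X| ≤ C4 + C5 + 2 ∧ |E2 + 1 - Y| ≤ C4 + C5 + 2 ∧
      n - (C4 + C5 + 2) ≤ E1 + 1 + (E2 + 1) := by
  have hC30 : 0 < C3 := by rw [hC3]; positivity
  have hC40 : 0 < C4 := by rw [hC4]; positivity
  have h2κ : 0 < 2 / κ := by positivity
  have hn0 : (0 : ℝ) < n := by linarith
  have Y0 : 0 < Y := lt_of_lt_of_le (mul_pos hκ hn0) h3
  have Yn : Y ≤ n := by linarith [mul_pos hκ hn0]
  -- E1 is large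
  have E1big : (n : ℝ) / 2 ≤ E1 := by
    have hsum : (n : ℝ) ^ 2 / 2 - C * n + 2 * κ ^ 2 * n ^ 2 ≤ X ^ 2 + Y ^ 2 := by
      have a : 2 * κ * n ≤ X - Y := by linarith
      have b : (2 * κ * n) ^ 2 ≤ (X - Y) ^ 2 := pow_le_pow_left₀ (by positivity) a 2
      have c : (n : ℝ) ^ 2 - 2 * C * n ≤ (X + Y) ^ 2 := by
        have c1 : 0 ≤ (n : ℝ) - C := by linarith [mul_le_mul_of_nonneg_right hκ1.le hn0.le]
        have := pow_le_pow_left₀ c1 h2 2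
        linarith [sq_nonneg C]
      linarith
    have i1 := mul_le_mul_of_nonneg_right t1 hn0.le
    have : (n : ℝ) / 2 * n ≤ E1 * n := by linarith
    exact le_of_mul_le_mul_right this hn0
  have gap : κ * n ≤ E1 - Y := by linarith
  have j1 : X - E1 ≤ C3 := by
    have hMle : M ≤ Y + (X - E1) + C := by linarith
    have hsq := pow_le_pow_left₀ M0 hMle 2
    obtain ⟨j, hj⟩ : ∃ j, j = X - E1 := ⟨_, rfl⟩
    have hE : E1 = X - j := by rw [hj]; ring
    rw [← hj] at *
    subst hE
    have hj1 : 1 ≤ j := by linarith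
    have k1 : 2 * j * (X - j - Y - C) ≤ 2 * n + 2 * Y * C + C ^ 2 := by linarith
    have k2 : κ * n / 2 ≤ X - j - Y - C := by linarith
    have k2' := mul_le_mul_of_nonneg_left k2 (by linarith : 0 ≤ 2 * j)
    have k3 : j * (κ * n) ≤ 2 * n + 2 * Y * C + C ^ 2 := by linarith
    have k4 : 2 * n + 2 * Y * C + C ^ 2 ≤ (2 + 2 * C + C ^ 2) * n := by
      have i1 : Y * C ≤ n * C := mul_le_mul_of_nonneg_right Yn hC.le
      have i2 : C ^ 2 * 1 ≤ C ^ 2 * n := mul_le_mul_of_nonneg_left (by linarith) (sq_nonneg C)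
      linarith
    rw [hC3, le_div_iff₀ hκ]
    have : (j * κ) * n ≤ (2 + 2 * C + C ^ 2) * n := by linarith
    exact le_of_mul_le_mul_right this hn0
  have hM4 : M ≤ Y + C4 := by rw [hC4]; linarith
  have e2low : Y - C5 ≤ E2 := by
    have a0 : E1 ^ 2 ≤ X ^ 2 := pow_le_pow_left₀ z1 (by linarith) 2
    have a1 : Y ^ 2 - 2 * n ≤ E2 * M := by linarith
    have a2 : E2 * M ≤ E2 * (Y + C4) := mul_le_mul_of_nonneg_left hM4 z2
    have a3 : (Y - C5) * (Y + C4) ≤ Y ^ 2 - 2 * n := by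
      have : 2 * n ≤ 2 / κ * Y := by
        rw [div_mul_eq_mul_div, le_div_iff₀ hκ]; linarith
      have e : (Y - C5) * (Y + C4) = Y ^ 2 - 2 / κ * Y - C4 ^ 2 - 2 / κ * C4 := by rw [hC5]; ring
      rw [e]
      linarith [mul_pos h2κ hC40, sq_nonneg C4]
    have : (Y - C5) * (Y + C4) ≤ E2 * (Y + C4) := by linarith
    exact le_of_mul_le_mul_right this (by positivity)
  refine ⟨?_, ?_, ?_⟩
  · rw [abs_le]; constructor <;> linarith
  · rw [abs_le]; constructor <;> linarith
  · linarith

lemma degs (C κ : ℝ) (hC : 0 < C) (hκ : 0 < κ) (hκ1 : κ < 1) :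
    ∃ K : ℝ, 0 < K ∧ ∃ N : ℕ, ∀ n : ℕ, N ≤ n → ∀ G : SimpleGraph (Fin n), G.IsTree → ∀ X Y : ℝ,
      X + Y ≤ n - 1 → n - C ≤ X + Y → κ * n ≤ Y → Y ≤ (1 / 2 - κ) * n → (1 / 2 + κ) * n ≤ X →
      X ^ 2 + Y ^ 2 + (n - 1) ≤ ∑ i, (deg G i : ℝ) ^ 2 → (∀ v, (deg G v : ℝ) ≤ X) →
      ∃ u1 u2 : Fin n, u1 ≠ u2 ∧ |(deg G u1 : ℝ) - X| ≤ K ∧ |(deg G u2 : ℝ) - Y| ≤ K ∧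
        n - K ≤ (deg G u1 : ℝ) + deg G u2 := by
  set C3 := (2 + 2 * C + C ^ 2) / κ with hC3
  have hC30 : 0 < C3 := by positivity
  have hC31 : C3 * κ = 2 + 2 * C + C ^ 2 := by rw [hC3]; field_simp
  set C4 := C3 + C with hC4
  set C5 := C4 + 2 / κ with hC5
  have h2κ : 0 < 2 / κ := by positivity
  obtain ⟨N, hN⟩ := exists_nat_gt ((C + 2) / (2 * κ ^ 2) + 2 * C / κ + 4)
  refine ⟨C4 + C5 + 2, by positivity, N, fun n hn G hG X Y h1 h2 h3 h4 h5 h6 h7 => ?_⟩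
  have hnN : (N : ℝ) ≤ n := by exact_mod_cast hn
  have w1 : 0 < (C + 2) / (2 * κ ^ 2) := by positivity
  have w2 : 0 < 2 * C / κ := by positivity
  have hn4 : (4 : ℝ) ≤ n := by linarith
  have hn4' : 4 ≤ n := by exact_mod_cast hn4
  have t1 : C + 2 ≤ 2 * κ ^ 2 * n := by
    have : (C + 2) / (2 * κ ^ 2) ≤ n := by linarith
    rw [div_le_iff₀ (by positivity)] at this; linarith
  have t2 : 2 * C ≤ κ * n := by
    have : 2 * C / κ ≤ n := by linarith
    rw [div_le_iff₀ (by positivity)] at this; linarith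
  have : Nontrivial (Fin n) := Fin.nontrivial_iff_two_le.mpr (by omega)
  have : Nonempty (Fin n) := inferInstance
  set e : Fin n → ℝ := fun v => (deg G v : ℝ) - 1 with he
  have e0 : ∀ v, 0 ≤ e v := by
    intro v
    have : 0 < G.degree v := hG.1.preconnected.degree_pos_of_nontrivial v
    have h : 1 ≤ deg G v := by rw [deg_eq_degree]; exact this
    have : (1 : ℝ) ≤ deg G v := by exact_mod_cast h
    simp only [he]; linarith
  have es : ∑ v, e v = n - 2 := by
    simp only [he, Finset.sum_sub_distrib, sum_deg_tree G hG]
    simp; ring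
  have es2 : X ^ 2 + Y ^ 2 - 2 * n + 3 ≤ ∑ v, e v ^ 2 := by
    have : ∑ v, e v ^ 2 = ∑ i, (deg G i : ℝ) ^ 2 - 2 * ∑ i, (deg G i : ℝ) + n := by
      rw [Finset.mul_sum, ← Finset.sum_sub_distrib]
      have hc : (n : ℝ) = ∑ _i : Fin n, (1 : ℝ) := by simp
      rw [hc, ← Finset.sum_add_distrib]
      exact Finset.sum_congr rfl fun i _ => by simp only [he]; ring
    rw [this, sum_deg_tree G hG]; linarith
  obtain ⟨u1, -, hu1⟩ := Finset.exists_max_image Finset.univ e Finset.univ_nonempty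
  have hsub : (Finset.univ.erase u1).Nonempty := by
    obtain ⟨w, hw⟩ := exists_ne u1
    exact ⟨w, by simp [hw]⟩
  obtain ⟨u2, hu2m, hu2⟩ := Finset.exists_max_image (Finset.univ.erase u1) e hsub
  have hne : u1 ≠ u2 := fun h => (Finset.ne_of_mem_erase hu2m) h.symm
  set M := ∑ v ∈ Finset.univ.erase u1, e v with hM
  have eM : e u1 + M = n - 2 := by
    rw [hM, Finset.add_sum_erase _ _ (Finset.mem_univ _), es]
  have M0 : 0 ≤ M := Finset.sum_nonneg fun v _ => e0 v
  have S1 : ∑ v, e v ^ 2 ≤ e u1 * (n - 2) := by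
    rw [← es, Finset.mul_sum]
    exact Finset.sum_le_sum fun v _ => by
      rw [sq]; exact mul_le_mul_of_nonneg_right (hu1 v (Finset.mem_univ _)) (e0 v)
  have S2 : ∑ v, e v ^ 2 = e u1 ^ 2 + ∑ v ∈ Finset.univ.erase u1, e v ^ 2 := by
    rw [Finset.add_sum_erase _ (fun v => e v ^ 2) (Finset.mem_univ _)]
  have S3 : ∑ v ∈ Finset.univ.erase u1, e v ^ 2 ≤ M ^ 2 :=
    Finset.sum_sq_le_sq_sum_of_nonneg fun v _ => e0 v
  have S4 : ∑ v ∈ Finset.univ.erase u1, e v ^ 2 ≤ e u2 * M := by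
    rw [hM, Finset.mul_sum]
    exact Finset.sum_le_sum fun v hv => by
      rw [sq]; exact mul_le_mul_of_nonneg_right (hu2 v hv) (e0 v)
  have S5 : e u2 ≤ M := Finset.single_le_sum (fun v _ => e0 v) hu2m
  have eX : e u1 + 1 ≤ X := by simp only [he]; linarith [h7 u1]
  have d1 : (deg G u1 : ℝ) = e u1 + 1 := by simp [he]
  have d2 : (deg G u2 : ℝ) = e u2 + 1 := by simp [he]
  refine ⟨u1, u2, hne, ?_⟩
  rw [d1, d2]
  have z1 := e0 u1
  have z2 := e0 u2
  exact degs_real C κ n C3 C4 C5 X Y M (e u1) (e u2) _ _ hC hκ hκ1 hC3 hC4 hC5 hn4 t1 t2 h1 h2 h3 h4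
    h5 es2 eM M0 S1 S2 S3 S4 S5 eX z1 z2

lemma deg_one_le {n : ℕ} (hn : 2 ≤ n) (G : SimpleGraph (Fin n)) (hG : G.IsTree) (v : Fin n) :
    (1 : ℝ) ≤ deg G v := by
  have : Nontrivial (Fin n) := Fin.nontrivial_iff_two_le.mpr hn
  have : 0 < G.degree v := hG.1.preconnected.degree_pos_of_nontrivial v
  have h : 1 ≤ deg G v := by rw [deg_eq_degree]; exact this
  exact_mod_cast h

lemma other_deg {n : ℕ} (hn : 2 ≤ n) (G : SimpleGraph (Fin n)) (hG : G.IsTree) (i j : Fin n)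
    (hij : i ≠ j) (v : Fin n) (hvi : v ≠ i) (hvj : v ≠ j) :
    (deg G v : ℝ) ≤ n - deg G i - deg G j + 1 := by
  have h1 : ∑ w, ((deg G w : ℝ) - 1) = n - 2 := by
    rw [Finset.sum_sub_distrib, sum_deg_tree G hG]; simp; ring
  have h2 : ∑ w ∈ ({i, j, v} : Finset (Fin n)), ((deg G w : ℝ) - 1) ≤ ∑ w, ((deg G w : ℝ) - 1) :=
    Finset.sum_le_sum_of_subset_of_nonneg (Finset.subset_univ _)
      fun w _ _ => by linarith [deg_one_le hn G hG w]
  rw [h1, Finset.sum_insert (by simp [hij, hvi.symm]), Finset.sum_insert (by simp [hvj.symm]),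
    Finset.sum_singleton] at h2
  linarith

lemma adj_nonneg {n : ℕ} (G : SimpleGraph (Fin n)) (v w : Fin n) : 0 ≤ adjMat G v w := by
  unfold adjMat; split_ifs <;> norm_num

lemma unit_abs_le {n : ℕ} (z : Fin n → ℝ) (hz : z ⬝ᵥ z = 1) (v : Fin n) : |z v| ≤ 1 := by
  rw [← sq_le_one_iff_abs_le_one, ← hz, sq]
  exact Finset.single_le_sum (f := fun v => z v * z v) (fun w _ => mul_self_nonneg _)
    (Finset.mem_univ v)

open Matrix in
lemma eig_apply {n : ℕ} (G : SimpleGraph (Fin n)) (z : Fin n → ℝ) (μ : ℝ)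
    (hz : adjMat G *ᵥ z = μ • z) (v : Fin n) : μ * z v = ∑ w, adjMat G v w * z w := by
  have := congrFun hz v
  simp only [mulVec, dotProduct, Pi.smul_apply, smul_eq_mul] at this
  exact this.symm

open Matrix in
lemma hub_est {n : ℕ} (hn : 2 ≤ n) (G : SimpleGraph (Fin n)) (hG : G.IsTree) (i j : Fin n)
    (hij : i ≠ j) (z : Fin n → ℝ) (μ : ℝ) (hμ : 0 ≤ μ) (hz : adjMat G *ᵥ z = μ • z)
    (hzz : z ⬝ᵥ z = 1) :
    |μ ^ 2 - deg G i| * |z i| ≤ μ + 1 + (n - deg G i - deg G j) := by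
  have hu := unit_abs_le z hzz
  have e1 : (μ ^ 2 - deg G i) * z i = ∑ v, adjMat G i v * (μ * z v - z i) := by
    have : ∑ v, adjMat G i v * (μ * z v - z i)
        = μ * ∑ v, adjMat G i v * z v - (∑ v, adjMat G i v) * z i := by
      rw [Finset.mul_sum, Finset.sum_mul, ← Finset.sum_sub_distrib]
      exact Finset.sum_congr rfl fun v _ => by ring
    rw [this, ← eig_apply G z μ hz i, adj_row_sum]; ring
  rw [← abs_mul, e1]
  refine (Finset.abs_sum_le_sum_abs _ _).trans ?_
  have hb : ∀ v, |adjMat G i v * (μ * z v - z i)| ≤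
      ((deg G v : ℝ) - 1) + (if v = i then 1 - (deg G i : ℝ) else 0)
        + (if v = j then μ + 2 - (deg G j : ℝ) else 0) := by
    intro v
    by_cases hvi : v = i
    · subst hvi
      simp [hij, adjMat]
    by_cases hvj : v = j
    · subst hvj
      simp only [hvi, if_false, if_true]
      have h1 : |adjMat G i v| ≤ 1 := by unfold adjMat; split_ifs <;> norm_num
      have h2 : |μ * z v - z i| ≤ μ + 1 := by
        refine (abs_sub _ _).trans ?_
        rw [abs_mul, abs_of_nonneg hμ]
        have := mul_le_mul_of_nonneg_left (hu v) hμ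
        linarith [hu i]
      rw [abs_mul]
      have := mul_le_mul h1 h2 (abs_nonneg _) zero_le_one
      linarith
    · simp only [hvi, hvj, if_false, add_zero]
      by_cases hA : G.Adj i v
      · have hA1 : adjMat G v i = 1 := by simp [adjMat, hA.symm]
        have hA2 : adjMat G i v = 1 := by simp [adjMat, hA]
        rw [hA2, one_mul, eig_apply G z μ hz v,
          ← Finset.add_sum_erase _ _ (Finset.mem_univ i), hA1, one_mul, add_sub_cancel_left]
        have hd : ∑ w ∈ Finset.univ.erase i, adjMat G v w = deg G v - 1 := by
          have := adj_row_sum G v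
          rw [← Finset.add_sum_erase _ _ (Finset.mem_univ i), hA1] at this
          linarith
        rw [← hd]
        refine (Finset.abs_sum_le_sum_abs _ _).trans (Finset.sum_le_sum fun w _ => ?_)
        rw [abs_mul, abs_of_nonneg (adj_nonneg G v w)]
        have := mul_le_mul_of_nonneg_left (hu w) (adj_nonneg G v w)
        linarith
      · have hA2 : adjMat G i v = 0 := by simp [adjMat, hA]
        rw [hA2]; simp
        have := deg_one_le hn G hG v
        exact_mod_cast this
  refine (Finset.sum_le_sum fun v _ => hb v).trans ?_
  rw [Finset.sum_add_distrib, Finset.sum_add_distrib, Finset.sum_sub_distrib, sum_deg_tree G hG]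
  simp
  linarith

open Matrix in
lemma mass_est {n : ℕ} (hn : 2 ≤ n) (G : SimpleGraph (Fin n)) (hG : G.IsTree) (i j : Fin n)
    (hij : i ≠ j) (z : Fin n → ℝ) (μ K : ℝ) (hμ : 0 < μ) (hz : adjMat G *ᵥ z = μ • z)
    (hzz : z ⬝ᵥ z = 1) (hK : n - deg G i - deg G j ≤ K) :
    |1 - 2 * (z i ^ 2 + z j ^ 2)| * μ ≤ 2 * K * (K + 1) ^ 2 / μ ^ 2 + 2 * (|z i| * |z j|) := by
  have hu := unit_abs_le z hzz
  set A := adjMat G with hA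
  set B := (K + 1) / μ with hB
  have hbv : ∀ v, v ≠ i → v ≠ j → |z v| ≤ B := by
    intro v hvi hvj
    rw [hB, le_div_iff₀ hμ]
    have h1 : |z v| * μ = |μ * z v| := by rw [abs_mul, abs_of_pos hμ, mul_comm]
    rw [h1, eig_apply G z μ hz v]
    refine (Finset.abs_sum_le_sum_abs _ _).trans ?_
    have h2 : ∑ w, |adjMat G v w * z w| ≤ ∑ w, adjMat G v w := by
      refine Finset.sum_le_sum fun w _ => ?_
      rw [abs_mul, abs_of_nonneg (adj_nonneg G v w)]
      have := mul_le_mul_of_nonneg_left (hu w) (adj_nonneg G v w)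
      linarith
    rw [adj_row_sum] at h2
    linarith [other_deg hn G hG i j hij v hvi hvj]
  -- generic expansion
  have expand : ∀ f : Fin n → ℝ,
      (f - f i • Pi.single i 1 - f j • Pi.single j 1) ⬝ᵥ
        (A *ᵥ (f - f i • Pi.single i 1 - f j • Pi.single j 1))
      = f ⬝ᵥ (A *ᵥ f) - 2 * (f i * (A *ᵥ f) i + f j * (A *ᵥ f) j) + 2 * (A i j * f i * f j) := by
    intro f
    have s1 : ∀ k, f ⬝ᵥ (A *ᵥ Pi.single k 1) = (A *ᵥ f) k := by
      intro k; rw [hA, adj_symm_dot]; simp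
    have s2 : A i i = 0 := by simp [hA, adjMat]
    have s3 : A j j = 0 := by simp [hA, adjMat]
    have s4 : A j i = A i j := by rw [hA]; exact adj_symm' G _ _
    simp only [mulVec_sub, mulVec_smul, sub_dotProduct, dotProduct_sub, smul_dotProduct,
      dotProduct_smul, smul_eq_mul, single_one_dotProduct, s1]
    simp only [mulVec_single_one, col_apply, s2, s3, s4]
    ring
  set r := z - z i • Pi.single i 1 - z j • Pi.single j 1 with hr
  set o : Fin n → ℝ := fun _ => 1 with ho
  set r1 : Fin n → ℝ := o - o i • Pi.single i 1 - o j • Pi.single j 1 with hr1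
  have E1 := expand z
  have E2 := expand o
  rw [← hr] at E1
  rw [← hr1] at E2
  have Ao : ∀ k, (A *ᵥ o) k = deg G k := by
    intro k; simp [mulVec, dotProduct, ho, hA, adj_row_sum]
  have oo : o ⬝ᵥ (A *ᵥ o) = 2 * ((n : ℝ) - 1) := by
    rw [← sum_deg_tree G hG]
    simp only [dotProduct, Ao]; simp [ho]
  rw [oo, Ao, Ao] at E2
  have Aij : A i j ≤ 1 := by rw [hA]; unfold adjMat; split_ifs <;> norm_num
  have Aij0 : 0 ≤ A i j := adj_nonneg G i j
  have E2' : r1 ⬝ᵥ (A *ᵥ r1) ≤ 2 * K := by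
    rw [E2]; simp only [ho]; linarith
  have zAz : z ⬝ᵥ (A *ᵥ z) = μ := by rw [hz]; simp [hzz]
  rw [zAz, hz] at E1
  simp only [Pi.smul_apply, smul_eq_mul] at E1
  have r1v : ∀ v, r1 v = if v = i ∨ v = j then 0 else 1 := by
    intro v
    by_cases hvi : v = i
    · subst hvi; simp [hr1, ho, hij]
    · by_cases hvj : v = j
      · subst hvj; simp [hr1, ho, hvi]
      · simp [hr1, ho, hvi, hvj]
  have rv : ∀ v, |r v| ≤ B * r1 v := by
    intro v
    rw [r1v]
    by_cases hvi : v = i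
    · subst hvi; simp [hr, hij]
    · by_cases hvj : v = j
      · subst hvj; simp [hr, hvi]
      · simp [hr, hvi, hvj]; exact hbv v hvi hvj
  have rAr : |r ⬝ᵥ (A *ᵥ r)| ≤ B ^ 2 * (r1 ⬝ᵥ (A *ᵥ r1)) := by
    simp only [dotProduct, mulVec, Finset.mul_sum]
    refine (Finset.abs_sum_le_sum_abs _ _).trans (Finset.sum_le_sum fun v _ => ?_)
    refine (Finset.abs_sum_le_sum_abs _ _).trans (Finset.sum_le_sum fun w _ => ?_)
    rw [abs_mul, abs_mul, abs_of_nonneg (adj_nonneg G v w)]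
    have h1 := mul_le_mul (rv v) (rv w) (abs_nonneg _) ((abs_nonneg _).trans (rv v))
    have h2 := mul_le_mul_of_nonneg_left h1 (adj_nonneg G v w)
    linarith
  have fin : (1 - 2 * (z i ^ 2 + z j ^ 2)) * μ = r ⬝ᵥ (A *ᵥ r) - 2 * (A i j * z i * z j) := by
    rw [E1]; ring
  have h3 : |A i j * z i * z j| ≤ |z i| * |z j| := by
    rw [mul_assoc, abs_mul, abs_mul, abs_of_nonneg Aij0]
    have := mul_le_mul_of_nonneg_right Aij (by positivity : 0 ≤ |z i| * |z j|)
    linarith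
  have h4 : |(1 - 2 * (z i ^ 2 + z j ^ 2)) * μ| = |1 - 2 * (z i ^ 2 + z j ^ 2)| * μ := by
    rw [abs_mul, abs_of_pos hμ]
  rw [← h4, fin]
  refine (abs_sub _ _).trans ?_
  have h5 : |2 * (A i j * z i * z j)| = 2 * |A i j * z i * z j| := by
    rw [abs_mul, abs_of_pos (by norm_num : (0 : ℝ) < 2)]
  rw [h5]
  have h6 := mul_le_mul_of_nonneg_left E2' (sq_nonneg B)
  have h7 : B ^ 2 * (2 * K) = 2 * K * (K + 1) ^ 2 / μ ^ 2 := by rw [hB]; field_simp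
  linarith

lemma exists_leaf {n : ℕ} (hn : 2 ≤ n) (G : SimpleGraph (Fin n)) (hG : G.IsTree) (i j : Fin n)
    (hij : i ≠ j) (hd : (n : ℝ) - deg G i - deg G j + 1 < deg G i) :
    ∃ l, G.Adj l i ∧ deg G l = 1 ∧ j ≠ l := by
  by_contra hcon
  push Not at hcon
  have hb : ∀ v, adjMat G i v ≤ ((deg G v : ℝ) - 1) + (if v = i then 1 - (deg G i : ℝ) else 0)
        + (if v = j then 2 - (deg G j : ℝ) else 0) := by
    intro v
    by_cases hvi : v = i
    · subst hvi; simp [hij, adjMat]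
    have h1 : adjMat G i v ≤ 1 := by unfold adjMat; split_ifs <;> norm_num
    by_cases hvj : v = j
    · subst hvj; simp only [hvi, if_false, if_true]; linarith
    · simp only [hvi, hvj, if_false, add_zero]
      have h2 := deg_one_le hn G hG v
      by_cases hA : G.Adj i v
      · have h3 : deg G v ≠ 1 := fun h => hvj (hcon v hA.symm h).symm
        have h4 : 1 ≤ deg G v := by exact_mod_cast h2
        have h5 : 2 ≤ deg G v := by omega
        have h6 : (2 : ℝ) ≤ deg G v := by exact_mod_cast h5
        linarith
      · have hA2 : adjMat G i v = 0 := by simp [adjMat, hA]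
        rw [hA2]; linarith
  have := Finset.sum_le_sum fun v (_ : v ∈ Finset.univ) => hb v
  rw [adj_row_sum, Finset.sum_add_distrib, Finset.sum_add_distrib, Finset.sum_sub_distrib,
    sum_deg_tree G hG] at this
  simp at this
  linarith

lemma frac_low (s : ℝ) (h1 : |s| ≤ 1 / 2) : s - 2 * s ^ 2 ≤ s / (1 + s) := by
  obtain ⟨h2, h3⟩ := abs_le.mp h1
  rw [le_div_iff₀ (by linarith)]
  nlinarith [mul_nonneg (sq_nonneg s) (by linarith : 0 ≤ 1 + 2 * s)]

/-- one term of the move estimate -/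
lemma term_low (R κ μ a : ℝ) (hR : 1 ≤ R) (hκ : 0 < κ) (hRκ : 2 ≤ κ ^ 2 * R ^ 2)
    (hμ : κ * R ≤ μ) (ha : |a| ≤ 1) :
    0 < 1 + a / μ ^ 2 ∧ 1 / 2 ≤ 1 + a / μ ^ 2 ∧
    a / μ - 2 / κ ^ 3 / R ^ 3 ≤ μ * (a / μ ^ 2) / (1 + a / μ ^ 2) := by
  have hκR : 0 < κ * R := by positivity
  have hμ0 : 0 < μ := lt_of_lt_of_le hκR hμ
  have h2 : 2 ≤ μ ^ 2 := by
    have := pow_le_pow_left₀ hκR.le hμ 2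
    nlinarith
  have hs : |a / μ ^ 2| ≤ 1 / 2 := by
    rw [abs_div, abs_of_pos (by positivity : 0 < μ ^ 2), div_le_iff₀ (by positivity)]
    linarith
  obtain ⟨h3, h4⟩ := abs_le.mp hs
  refine ⟨by linarith, by linarith, ?_⟩
  have h5 := mul_le_mul_of_nonneg_left (frac_low _ hs) hμ0.le
  rw [mul_div_assoc]
  refine le_trans ?_ h5
  have e : μ * (a / μ ^ 2 - 2 * (a / μ ^ 2) ^ 2) = a / μ - 2 * a ^ 2 / μ ^ 3 := by field_simp
  rw [e]
  have h6 : 2 * a ^ 2 / μ ^ 3 ≤ 2 / κ ^ 3 / R ^ 3 := by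
    rw [div_div, ← mul_pow]
    have ha2 : a ^ 2 ≤ 1 := (sq_le_one_iff_abs_le_one a).mpr ha
    apply div_le_div₀ (by norm_num) (by linarith) (by positivity)
    exact pow_le_pow_left₀ hκR.le hμ 3
  linarith

lemma move_real (α β κ R x y a b E γ D F σ : ℝ) (hα : 0 < α) (hβ : 0 < β) (hab : α + β = 1)
    (hκ : 0 < κ) (hR : 1 ≤ R) (hRκ : 2 ≤ κ ^ 2 * R ^ 2) (hx : κ * R ≤ x) (hy : κ * R ≤ y)
    (hxR : x ≤ R) (hyR : y ≤ R) (ha : |a| ≤ 1) (hb : |b| ≤ 1) (hγ : 0 ≤ γ)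
    (hE0 : 0 ≤ E) (hE : E ≤ D / R ^ 2) (hF : 0 ≤ F)
    (ha2 : |a + σ / 2| ≤ F / R ^ 2) (hb2 : |b - σ / 2| ≤ F / R ^ 2)
    (hmain : α * (x + x * (a / x ^ 2) / (1 + a / x ^ 2)) + β * (y + y * (b / y ^ 2) / (1 + b / y ^ 2))
      ≤ α * x + β * y + 4 * R * (γ * (E / (x ^ 2 * y ^ 2 * (1 + a / x ^ 2) * (1 + b / y ^ 2))))) :
    σ * (β * x - α * y) ≤ 2 * (2 / κ ^ 3 + 16 * γ * D / κ ^ 4 + F / κ) / R := by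
  have hκR : 0 < κ * R := by positivity
  have hx0 : 0 < x := lt_of_lt_of_le hκR hx
  have hy0 : 0 < y := lt_of_lt_of_le hκR hy
  obtain ⟨p1, p2, p3⟩ := term_low R κ x a hR hκ hRκ hx ha
  obtain ⟨q1, q2, q3⟩ := term_low R κ y b hR hκ hRκ hy hb
  have hD : 0 ≤ D := by
    have : 0 ≤ D / R ^ 2 := hE0.trans hE
    rwa [le_div_iff₀ (by positivity), zero_mul] at this
  -- error
  have err : 4 * R * (γ * (E / (x ^ 2 * y ^ 2 * (1 + a / x ^ 2) * (1 + b / y ^ 2))))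
      ≤ 16 * γ * D / κ ^ 4 / R ^ 3 := by
    have den : κ ^ 4 * R ^ 4 / 4 ≤ x ^ 2 * y ^ 2 * (1 + a / x ^ 2) * (1 + b / y ^ 2) := by
      have i1 := pow_le_pow_left₀ hκR.le hx 2
      have i2 := pow_le_pow_left₀ hκR.le hy 2
      have i3 := mul_le_mul i1 i2 (by positivity) (by positivity)
      have i4 := mul_le_mul i3 p2 (by norm_num) (by positivity)
      have i5 := mul_le_mul i4 q2 (by norm_num) (by positivity)
      refine le_trans (le_of_eq ?_) i5
      ring
    have h1 : E / (x ^ 2 * y ^ 2 * (1 + a / x ^ 2) * (1 + b / y ^ 2)) ≤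
        (D / R ^ 2) / (κ ^ 4 * R ^ 4 / 4) :=
      div_le_div₀ (by positivity) hE (by positivity) den
    have h2 : 4 * R * (γ * (E / (x ^ 2 * y ^ 2 * (1 + a / x ^ 2) * (1 + b / y ^ 2)))) ≤
        4 * R * (γ * ((D / R ^ 2) / (κ ^ 4 * R ^ 4 / 4))) := by gcongr
    refine h2.trans ?_
    have h3 : 4 * R * (γ * ((D / R ^ 2) / (κ ^ 4 * R ^ 4 / 4))) =
      16 * γ * D / κ ^ 4 / R ^ 5 := by field_simp; ring
    rw [h3]
    apply div_le_div_of_nonneg_left (by positivity) (by positivity)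
    exact pow_le_pow_right₀ hR (by norm_num)
  have r1 := mul_le_mul_of_nonneg_left p3 hα.le
  have r2 := mul_le_mul_of_nonneg_left q3 hβ.le
  have r3 : α * (a / x) + β * (b / y) ≤ (2 / κ ^ 3 + 16 * γ * D / κ ^ 4) / R ^ 3 := by
    rw [add_div]
    have : (α + β) * (2 / κ ^ 3 / R ^ 3) = 2 / κ ^ 3 / R ^ 3 := by rw [hab, one_mul]
    linarith
  -- replace a, b
  have lowgen : ∀ c μ : ℝ, κ * R ≤ μ → |c| ≤ F / R ^ 2 → -(F / κ / R ^ 3) ≤ c / μ := by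
    intro c μ hμ hc
    have hμ0 : 0 < μ := lt_of_lt_of_le hκR hμ
    have h1 : |c / μ| ≤ F / κ / R ^ 3 := by
      rw [abs_div, abs_of_pos hμ0]
      have : F / κ / R ^ 3 = (F / R ^ 2) / (κ * R) := by field_simp
      rw [this]
      exact div_le_div₀ (by positivity) hc hκR hμ
    exact (abs_le.mp h1).1
  have s1 := mul_le_mul_of_nonneg_left (lowgen _ x hx ha2) hα.le
  have s2 := mul_le_mul_of_nonneg_left (lowgen _ y hy hb2) hβ.le
  have s3 : σ * (β / (2 * y) - α / (2 * x)) ≤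
      (2 / κ ^ 3 + 16 * γ * D / κ ^ 4 + F / κ) / R ^ 3 := by
    rw [add_div]
    have e1 : α * ((a + σ / 2) / x) = α * (a / x) + σ * (α / (2 * x)) := by field_simp
    have e2 : β * ((b - σ / 2) / y) = β * (b / y) - σ * (β / (2 * y)) := by field_simp
    have e3 : (α + β) * (F / κ / R ^ 3) = F / κ / R ^ 3 := by rw [hab, one_mul]
    rw [e1] at s1
    rw [e2] at s2
    linarith
  set Q := 2 / κ ^ 3 + 16 * γ * D / κ ^ 4 + F / κ with hQ
  have Q0 : 0 ≤ Q := by positivity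
  have s4 := mul_le_mul_of_nonneg_left s3 (by positivity : 0 ≤ 2 * (x * y))
  have e4 : 2 * (x * y) * (σ * (β / (2 * y) - α / (2 * x))) = σ * (β * x - α * y) := by
    field_simp
  rw [e4] at s4
  refine s4.trans ?_
  have hxy : x * y ≤ R * R := mul_le_mul hxR hyR hy0.le (by linarith)
  have s5 : 2 * (x * y) * (Q / R ^ 3) ≤ 2 * (R * R) * (Q / R ^ 3) := by gcongr
  refine s5.trans (le_of_eq ?_)
  field_simp

lemma small_real (K κ R μ d r : ℝ) (hκ : 0 < κ) (hR : 1 ≤ R) (hK : 0 ≤ K) (hμ : μ ≤ R)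
    (hgap : κ * R ^ 2 ≤ |μ ^ 2 - d|) (h : |μ ^ 2 - d| * |r| ≤ μ + 1 + K) :
    |r| ≤ (2 + K) / κ / R := by
  have h1 : κ * R ^ 2 * |r| ≤ (2 + K) * R := by
    have := mul_le_mul_of_nonneg_right hgap (abs_nonneg r)
    nlinarith
  rw [div_div, le_div_iff₀ (by positivity)]
  have : (|r| * (κ * R)) * R ≤ (2 + K) * R := by nlinarith
  exact le_of_mul_le_mul_right this (by linarith)

lemma mass_real (K κ R μ p r D : ℝ) (hκ : 0 < κ) (hR : 1 ≤ R) (hK : 0 ≤ K) (hμ : κ * R ≤ μ)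
    (hp : |p| ≤ 1) (hr : |r| ≤ D / R)
    (h : |1 - 2 * (p ^ 2 + r ^ 2)| * μ ≤ 2 * K * (K + 1) ^ 2 / μ ^ 2 + 2 * (|p| * |r|)) :
    |r ^ 2 - p ^ 2 + 1 / 2| ≤ (2 * K * (K + 1) ^ 2 / κ ^ 3 + 2 * D / κ + 2 * D ^ 2) / R ^ 2 := by
  have hκR : 0 < κ * R := by positivity
  have hμ0 : 0 < μ := lt_of_lt_of_le hκR hμ
  have hD : 0 ≤ D := by
    have : 0 ≤ D / R := (abs_nonneg r).trans hr
    rwa [le_div_iff₀ (by positivity), zero_mul] at this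
  have h1 : |1 - 2 * (p ^ 2 + r ^ 2)| ≤ (2 * K * (K + 1) ^ 2 / κ ^ 3 + 2 * D / κ) / R ^ 2 := by
    have i1 : |1 - 2 * (p ^ 2 + r ^ 2)| ≤
        (2 * K * (K + 1) ^ 2 / μ ^ 2 + 2 * (|p| * |r|)) / μ := by
      rw [le_div_iff₀ hμ0]; exact h
    refine i1.trans ?_
    rw [add_div, add_div]
    apply add_le_add
    · rw [div_div, div_div]
      apply div_le_div_of_nonneg_left (by positivity) (by positivity)
      have i2 := pow_le_pow_left₀ hκR.le hμ 3
      have i3 : R ^ 2 ≤ R ^ 3 := pow_le_pow_right₀ hR (by norm_num)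
      have i4 : κ ^ 3 * R ^ 2 ≤ κ ^ 3 * R ^ 3 := by gcongr
      calc κ ^ 3 * R ^ 2 ≤ κ ^ 3 * R ^ 3 := i4
        _ = (κ * R) ^ 3 := by ring
        _ ≤ μ ^ 3 := i2
        _ = μ ^ 2 * μ := by ring
    · have i5 : |p| * |r| ≤ D / R := by
        have := mul_le_mul hp hr (abs_nonneg _) zero_le_one
        linarith
      have i6 : 2 * D / κ / R ^ 2 = (2 * (D / R)) / (κ * R) := by field_simp
      rw [i6]
      exact div_le_div₀ (by positivity) (by linarith) hκR hμ
  have h2 : r ^ 2 ≤ D ^ 2 / R ^ 2 := by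
    rw [← sq_abs, ← div_pow]
    exact pow_le_pow_left₀ (abs_nonneg _) hr 2
  rw [add_div _ (2 * D ^ 2)]
  have h3 : 2 * D ^ 2 / R ^ 2 = 2 * (D ^ 2 / R ^ 2) := by ring
  rw [h3]
  have h0 := sq_nonneg r
  have hB : 0 ≤ (2 * K * (K + 1) ^ 2 / κ ^ 3 + 2 * D / κ) / R ^ 2 := by positivity
  obtain ⟨g1, g2⟩ := abs_le.mp h1
  rw [abs_le]
  constructor <;> linarith

lemma final_real (α β n x y C Q R : ℝ) (hα : 0 < α) (hβ : 0 < β) (hab : α + β = 1) (hC : 0 < C)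
    (hR : 0 < R) (hx0 : 0 < x) (hy0 : 0 < y) (hxR : x ≤ R) (hyR : y ≤ R)
    (h1 : x ^ 2 + y ^ 2 ≤ n - 1) (h2 : n - C ≤ x ^ 2 + y ^ 2)
    (h3 : β * x - α * y ≤ Q / R) (h4 : -(β * x - α * y) ≤ Q / R) :
    |x ^ 2 - α ^ 2 / (α ^ 2 + β ^ 2) * n| ≤ C + Q / (α ^ 2 + β ^ 2) ∧
    |y ^ 2 - (1 - α ^ 2 / (α ^ 2 + β ^ 2)) * n| ≤ 2 * C + Q / (α ^ 2 + β ^ 2) := by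
  have hq0 : 0 < α ^ 2 + β ^ 2 := by positivity
  have hd : |β ^ 2 * x ^ 2 - α ^ 2 * y ^ 2| ≤ Q := by
    have : β ^ 2 * x ^ 2 - α ^ 2 * y ^ 2 = (β * x - α * y) * (β * x + α * y) := by ring
    rw [this, abs_mul, abs_of_pos (by positivity : 0 < β * x + α * y)]
    have h5 : |β * x - α * y| ≤ Q / R := abs_le.mpr ⟨by linarith, h3⟩
    have h6 : β * x + α * y ≤ R := by
      have i1 := mul_le_mul_of_nonneg_left hxR hβ.le
      have i2 := mul_le_mul_of_nonneg_left hyR hα.le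
      have i3 : R = α * R + β * R := by rw [← add_mul, hab, one_mul]
      linarith
    have h7 := mul_le_mul h5 h6 (by positivity) ((abs_nonneg _).trans h5)
    rwa [div_mul_cancel₀ _ hR.ne'] at h7
  set q := α ^ 2 + β ^ 2 with hq
  set t := α ^ 2 / q with ht
  have ht0 : 0 ≤ t := by positivity
  have ht1 : t ≤ 1 := by rw [ht, div_le_one hq0, hq]; linarith [sq_nonneg β]
  have e : x ^ 2 - t * n = t * (x ^ 2 + y ^ 2 - n) + (β ^ 2 * x ^ 2 - α ^ 2 * y ^ 2) / q := by
    rw [ht]; field_simp; rw [hq]; ring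
  have b1 : |(β ^ 2 * x ^ 2 - α ^ 2 * y ^ 2) / q| ≤ Q / q := by
    rw [abs_div, abs_of_pos hq0]; exact div_le_div_of_nonneg_right hd hq0.le
  have b2 : |x ^ 2 + y ^ 2 - n| ≤ C := by rw [abs_le]; constructor <;> linarith
  have b3 : |t * (x ^ 2 + y ^ 2 - n)| ≤ C := by
    rw [abs_mul, abs_of_nonneg ht0]
    have := mul_le_mul ht1 b2 (abs_nonneg _) zero_le_one
    linarith
  have g1 : |x ^ 2 - t * n| ≤ C + Q / q := by
    rw [e]; exact (abs_add_le _ _).trans (add_le_add b3 b1)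
  refine ⟨g1, ?_⟩
  have e2 : y ^ 2 - (1 - t) * n = (x ^ 2 + y ^ 2 - n) - (x ^ 2 - t * n) := by ring
  rw [e2]
  refine (abs_sub _ _).trans ?_
  linarith

open Matrix in
lemma one_move {n : ℕ} (hn : 2 ≤ n) (G : SimpleGraph (Fin n)) (α β κ R x y D F σ : ℝ)
    (hα : 0 < α) (hβ : 0 < β) (hβα : β < α) (hab : α + β = 1) (hG : PsiMax α β G)
    (hx1 : lam 1 G = x) (hy1 : lam 2 G = y)
    (l p q : Fin n) (hlp : G.Adj l p) (hd : deg G l = 1) (hql : q ≠ l)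
    (z w : Fin n → ℝ) (hz : adjMat G *ᵥ z = x • z) (hw : adjMat G *ᵥ w = y • w)
    (hzz : z ⬝ᵥ z = 1) (hww : w ⬝ᵥ w = 1) (hzw : z ⬝ᵥ w = 0)
    (hκ : 0 < κ) (hRn : R = √(n : ℝ)) (hR : 1 ≤ R) (hRκ : 2 ≤ κ ^ 2 * R ^ 2)
    (hx : κ * R ≤ x) (hy : κ * R ≤ y) (hxR : x ≤ R) (hyR : y ≤ R)
    (hE : |z q * w q - z p * w p| ≤ D / R) (hF : 0 ≤ F)
    (ha2 : |z q ^ 2 - z p ^ 2 + σ / 2| ≤ F / R ^ 2)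
    (hb2 : |w q ^ 2 - w p ^ 2 - σ / 2| ≤ F / R ^ 2) :
    σ * (β * x - α * y) ≤
      2 * (2 / κ ^ 3 + 16 * (α * β / (α - β)) * D ^ 2 / κ ^ 4 + F / κ) / R := by
  have hκR : 0 < κ * R := by positivity
  have hx0 : 0 < x := lt_of_lt_of_le hκR hx
  have hy0 : 0 < y := lt_of_lt_of_le hκR hy
  have hsub : 0 < α - β := by linarith
  have sqd : ∀ f : Fin n → ℝ, f ⬝ᵥ f = 1 → |f q ^ 2 - f p ^ 2| ≤ 1 := by
    intro f hf
    have h1 := (sq_le_one_iff_abs_le_one _).mpr (unit_abs_le f hf p)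
    have h2 := (sq_le_one_iff_abs_le_one _).mpr (unit_abs_le f hf q)
    rw [abs_le]
    constructor <;> linarith [sq_nonneg (f p), sq_nonneg (f q)]
  have ha := sqd z hzz
  have hb := sqd w hww
  obtain ⟨p1, -, -⟩ := term_low R κ x _ hR hκ hRκ hx ha
  obtain ⟨q1, -, -⟩ := term_low R κ y _ hR hκ hRκ hy hb
  obtain ⟨T, hT, hTi⟩ := move_ineq hn G hG.1 l p q hlp hd hql z w x y α β hz hw hzz hww hzw
    hx0.ne' hy0.ne' hβ.le hβα _ _ rfl rfl p1 q1
  have hmax := hG.2 T hT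
  rw [hx1, hy1] at hmax
  rw [← hRn] at hTi
  refine move_real α β κ R x y (z q ^ 2 - z p ^ 2) (w q ^ 2 - w p ^ 2)
    ((z q * w q - z p * w p) ^ 2) (α * β / (α - β)) (D ^ 2) F σ hα hβ hab hκ hR hRκ hx hy hxR hyR ha hb
    (by positivity) (sq_nonneg _) ?_ hF ha2 hb2 (by linarith)
  rw [← sq_abs, ← div_pow]
  exact pow_le_pow_left₀ (abs_nonneg _) hE 2

set_option maxHeartbeats 1000000 in
open Matrix in
lemma main_aux (α β : ℝ) (hβ : 0 < β) (hβα : β < α) (hab : α + β = 1) :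
    ∃ C : ℝ, 0 < C ∧ ∃ N : ℕ, ∀ n : ℕ, N ≤ n → ∀ G : SimpleGraph (Fin n), PsiMax α β G →
        ∃ u1 u2 : Fin n, u1 ≠ u2 ∧
          |(deg G u1 : ℝ) - (α ^ 2 / (α ^ 2 + β ^ 2)) * n| ≤ C ∧
          |(deg G u2 : ℝ) - (1 - α ^ 2 / (α ^ 2 + β ^ 2)) * n| ≤ C ∧
          ∀ u : Fin n, u ≠ u1 → u ≠ u2 → (deg G u : ℝ) ≤ C := by
  have hα : 0 < α := hβ.trans hβα
  have hsub : 0 < α - β := by linarith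
  obtain ⟨C, hC, N1, hN12, H1⟩ := first_order α β hβ hβα hab
  obtain ⟨κ, hκ, hκ1, N2, H2⟩ := gap_bounds α β hβ hβα C hC
  obtain ⟨K, hK, N3, H3⟩ := degs C κ hC hκ hκ1
  obtain ⟨N4, hN4⟩ := exists_nat_gt ((2 * K + 1) / κ + 2 / κ ^ 2 + 1)
  obtain ⟨D, hD⟩ : ∃ D, D = (2 + K) / κ := ⟨_, rfl⟩
  have hD0 : 0 < D := by rw [hD]; positivity
  obtain ⟨F, hF⟩ : ∃ F, F = 2 * K * (K + 1) ^ 2 / κ ^ 3 + 2 * D / κ + 2 * D ^ 2 := ⟨_, rfl⟩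
  have hF0 : 0 < F := by rw [hF]; positivity
  obtain ⟨Q, hQ⟩ : ∃ Q, Q = 2 * (2 / κ ^ 3 + 16 * (α * β / (α - β)) * (2 * D) ^ 2 / κ ^ 4 + F / κ) :=
    ⟨_, rfl⟩
  have hQ0 : 0 < Q := by rw [hQ]; positivity
  have hq0 : 0 < Q / (α ^ 2 + β ^ 2) := by positivity
  refine ⟨2 * C + Q / (α ^ 2 + β ^ 2) + K + 1, by positivity,
    max (max N1 N2) (max N3 N4), fun n hn G hG => ?_⟩
  have hn1 : N1 ≤ n := (le_max_left _ _).trans ((le_max_left _ _).trans hn)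
  have hn2 : N2 ≤ n := (le_max_right _ _).trans ((le_max_left _ _).trans hn)
  have hn3 : N3 ≤ n := (le_max_left _ _).trans ((le_max_right _ _).trans hn)
  have hn4 : N4 ≤ n := (le_max_right _ _).trans ((le_max_right _ _).trans hn)
  have hn : 2 ≤ n := hN12.trans hn1
  have hnN : (N4 : ℝ) ≤ n := by exact_mod_cast hn4
  have w1 : 0 < (2 * K + 1) / κ := by positivity
  have w2 : 0 < 2 / κ ^ 2 := by positivity
  have nK : 2 * K + 1 < κ * n := by
    have : (2 * K + 1) / κ < n := by linarith
    rw [div_lt_iff₀ hκ] at this; linarith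
  have nκ : 2 ≤ κ ^ 2 * n := by
    have : 2 / κ ^ 2 ≤ n := by linarith
    rw [div_le_iff₀ (by positivity)] at this; linarith
  obtain ⟨a1, a2, a3, a4, a5⟩ := H1 n hn1 G hG
  have a6 := (lam12_bounds hn G hG.1 a1).2
  have a7 := fun v => deg_le_lam hn G v (a1.le.trans a2)
  obtain ⟨v, L, hv, hL, -, -, hl1, hl2⟩ := spec hn G
  have hzz := hv ⟨0, by omega⟩ ⟨0, by omega⟩
  have hww := hv ⟨1, by omega⟩ ⟨1, by omega⟩
  have hzw := hv ⟨0, by omega⟩ ⟨1, by omega⟩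
  have hz := hL ⟨0, by omega⟩
  have hw := hL ⟨1, by omega⟩
  rw [← hl1] at hz
  rw [← hl2] at hw
  simp only [if_true] at hzz hww
  rw [if_neg (by simp)] at hzw
  generalize v ⟨0, by omega⟩ = z at hz hzz hzw
  generalize v ⟨1, by omega⟩ = w at hw hww hzw
  clear hv hL hl1 hl2
  obtain ⟨x, hx1⟩ : ∃ x, lam 1 G = x := ⟨_, rfl⟩
  obtain ⟨y, hy1⟩ : ∃ y, lam 2 G = y := ⟨_, rfl⟩
  simp only [hx1, hy1] at a1 a2 a3 a4 a5 a6 a7 hz hw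
  obtain ⟨b1, b2, b3⟩ := H2 n hn2 x y a1 a2 a3 a4 a5
  obtain ⟨u1, u2, hne, c1, c2, c3⟩ := H3 n hn3 G hG.1 (x ^ 2) (y ^ 2) a3 a4 b1 b2 b3 a6 a7
  refine ⟨u1, u2, hne, ?_⟩
  obtain ⟨R, hRn⟩ : ∃ R, R = √(n : ℝ) := ⟨_, rfl⟩
  have R2 : R ^ 2 = n := by rw [hRn]; exact Real.sq_sqrt (Nat.cast_nonneg n)
  have n0 : (0 : ℝ) ≤ n := Nat.cast_nonneg n
  have R1 : 1 ≤ R := by rw [hRn]; exact Real.one_le_sqrt.mpr (by linarith)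
  have R0 : 0 < R := by linarith
  have hx0 : 0 < x := lt_of_lt_of_le a1 a2
  have xR : x ≤ R := by
    rw [hRn]; apply Real.le_sqrt_of_sq_le; linarith [sq_nonneg y]
  have yR : y ≤ R := a2.trans xR
  have yκ : κ * R ≤ y := by
    refine (le_abs_self _).trans (abs_le_of_sq_le_sq ?_ a1.le)
    rw [mul_pow, R2]
    refine le_trans ?_ b1
    exact mul_le_mul_of_nonneg_right (pow_le_of_le_one hκ.le hκ1.le two_ne_zero) n0
  have xκ : κ * R ≤ x := yκ.trans a2
  obtain ⟨c11, c12⟩ := abs_le.mp c1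
  obtain ⟨c21, c22⟩ := abs_le.mp c2
  have d2n := deg_one_le hn G hG.1 u2
  have d1n := deg_one_le hn G hG.1 u1
  have hgap : 2 * κ * n ≤ x ^ 2 - y ^ 2 := by linarith
  -- small entries
  have z2 : |z u2| ≤ D / R := by
    rw [hD]
    have h := hub_est hn G hG.1 u2 u1 hne.symm z x hx0.le hz hzz
    refine small_real K κ R x (deg G u2) _ hκ R1 hK.le xR ?_ (h.trans (by linarith))
    rw [R2]
    refine le_trans ?_ (le_abs_self _)
    linarith
  have w1' : |w u1| ≤ D / R := by
    rw [hD]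
    have h := hub_est hn G hG.1 u1 u2 hne w y a1.le hw hww
    refine small_real K κ R y (deg G u1) _ hκ R1 hK.le yR ?_ (h.trans (by linarith))
    rw [R2]
    refine le_trans ?_ (neg_le_abs _)
    linarith
  have Z1 := unit_abs_le z hzz u1
  have W2 := unit_abs_le w hww u2
  have mz := mass_real K κ R x (z u1) (z u2) D hκ R1 hK.le xκ Z1 z2
    (mass_est hn G hG.1 u1 u2 hne z x K hx0 hz hzz (by linarith))
  have mw := mass_real K κ R y (w u2) (w u1) D hκ R1 hK.le yκ W2 w1'
    (mass_est hn G hG.1 u2 u1 hne.symm w y K a1 hw hww (by linarith))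
  rw [← hF] at mz mw
  have hE : |z u2 * w u2 - z u1 * w u1| ≤ 2 * D / R := by
    refine (abs_sub _ _).trans ?_
    rw [abs_mul, abs_mul]
    have i1 := mul_le_mul z2 W2 (abs_nonneg _) (by positivity)
    have i2 := mul_le_mul Z1 w1' (abs_nonneg _) (by positivity)
    have i3 : 2 * D / R = D / R * 1 + 1 * (D / R) := by ring
    linarith
  have hRκ : 2 ≤ κ ^ 2 * R ^ 2 := by rw [R2]; exact nκ
  -- leaves
  have κn : 0 ≤ κ * n := by positivity
  obtain ⟨l1, l1a, l1d, l1n⟩ := exists_leaf hn G hG.1 u1 u2 hne (by linarith)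
  obtain ⟨l2, l2a, l2d, l2n⟩ := exists_leaf hn G hG.1 u2 u1 hne.symm (by linarith)
  have mv1 := one_move hn G α β κ R x y (2 * D) F 1 hα hβ hβα hab hG hx1 hy1 l1 u1 u2 l1a l1d l1n
    z w hz hw hzz hww hzw hκ hRn R1 hRκ xκ yκ xR yR hE hF0.le mz
    (by rw [← abs_neg]; convert mw using 2; ring)
  have mv2 := one_move hn G α β κ R x y (2 * D) F (-1) hα hβ hβα hab hG hx1 hy1 l2 u2 u1 l2a l2d l2n
    z w hz hw hzz hww hzw hκ hRn R1 hRκ xκ yκ xR yR (by rw [abs_sub_comm]; exact hE) hF0.le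
    (by rw [← abs_neg]; convert mz using 2; ring) (by convert mw using 2; ring)
  rw [← hQ] at mv1 mv2
  obtain ⟨f1, f2⟩ := final_real α β n x y C Q R hα hβ hab hC R0 hx0 a1 xR yR a3 a4
    (by linarith) (by linarith)
  refine ⟨?_, ?_, ?_⟩
  · have : (deg G u1 : ℝ) - (α ^ 2 / (α ^ 2 + β ^ 2)) * n
        = ((deg G u1 : ℝ) - x ^ 2) + (x ^ 2 - (α ^ 2 / (α ^ 2 + β ^ 2)) * n) := by ring
    rw [this]
    refine (abs_add_le _ _).trans ?_
    linarith
  · have : (deg G u2 : ℝ) - (1 - α ^ 2 / (α ^ 2 + β ^ 2)) * n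
        = ((deg G u2 : ℝ) - y ^ 2) + (y ^ 2 - (1 - α ^ 2 / (α ^ 2 + β ^ 2)) * n) := by ring
    rw [this]
    refine (abs_add_le _ _).trans ?_
    linarith
  · intro u h1 h2
    have := other_deg hn G hG.1 u1 u2 hne u h1 h2
    linarith

/-- For fixed `1/2 < α < 1` with `t = α²/(α² + (1-α)²)`, there are `C > 0` and `N` such
that for all `n ≥ N`, every maximizer `T*` of `Ψ(·, α)` among trees on `n` vertices has two
distinct vertices of degree `≈ t·n` and `≈ (1-t)·n` (within `C`), all other degrees being
at most `C`. -/
theorem psi_max_degree_estimates (α : ℝ) (hα0 : 1 / 2 < α) (hα1 : α < 1) :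
    ∃ C : ℝ, 0 < C ∧ ∃ N : ℕ, ∀ n : ℕ, N ≤ n →
      ∀ Tstar : SimpleGraph (Fin n), Tstar.IsTree →
        (∀ T : SimpleGraph (Fin n), T.IsTree →
          α * lam 1 T + (1 - α) * lam 2 T ≤
            α * lam 1 Tstar + (1 - α) * lam 2 Tstar) →
        ∃ u1 u2 : Fin n, u1 ≠ u2 ∧
          |(deg Tstar u1 : ℝ) - (α ^ 2 / (α ^ 2 + (1 - α) ^ 2)) * n| ≤ C ∧
          |(deg Tstar u2 : ℝ) - (1 - α ^ 2 / (α ^ 2 + (1 - α) ^ 2)) * n| ≤ C ∧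
          ∀ u : Fin n, u ≠ u1 → u ≠ u2 → (deg Tstar u : ℝ) ≤ C := by
  obtain ⟨C, hC, N, h⟩ := main_aux α (1 - α) (by linarith) (by linarith) (by ring)
  exact ⟨C, hC, N, fun n hn T hT hmax => h n hn T ⟨hT, hmax⟩⟩
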